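/- arXiv:1706.02373 — 7 statements merged into one kernel-verified Lean document; each statement's English description precedes it below -/
import Mathlib

section
/- Let n ≥ 1 and let f : ℝⁿ → [0,∞) be an integrable log-concave function with 0 < ∫_{ℝⁿ} f(x) dx < ∞, ∫_{ℝⁿ} ‖x‖ f(x) dx < ∞, and center of mass at the origin, i.e., ∫_{ℝⁿ} x f(x) dx = 0. Then for every unit vector θ ∈ Sⁿ⁻¹, ∫_0^∞ f(sθ) ds ≥ e^{-n} ∫_{-∞}^∞ f(sθ) ds. -/
open MeasureTheory Real Set

lemma volume_add_volume_le_of_isCompact {A B C : Set ℝ} (hA : IsCompact A) (hB : IsCompact B)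
    (hA' : A.Nonempty) (hB' : B.Nonempty) (h : ∀ a ∈ A, ∀ b ∈ B, a + b ∈ C) :
    volume A + volume B ≤ volume C := by
  obtain ⟨a, ha, ha'⟩ := hA.exists_isGreatest hA'
  obtain ⟨b, hb, hb'⟩ := hB.exists_isLeast hB'
  have hdisj : AEDisjoint volume ((fun x ↦ x + b) '' A) ((fun x ↦ a + x) '' B) := by
    refine measure_mono_null (t := {a + b}) ?_ (by simp)
    rintro _ ⟨⟨x, hx, rfl⟩, ⟨y, hy, hxy⟩⟩
    have h1 := ha' hx
    have h2 := hb' hy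
    simp only [mem_singleton_iff] at *
    linarith
  have hm : MeasurableSet ((fun x ↦ a + x) '' B) :=
    (hB.image (continuous_const_add a)).measurableSet
  calc volume A + volume B
      = volume ((fun x ↦ x + b) '' A) + volume ((fun x ↦ a + x) '' B) := by simp
    _ = volume ((fun x ↦ x + b) '' A ∪ (fun x ↦ a + x) '' B) :=
        (measure_union₀ hm.nullMeasurableSet hdisj).symm
    _ ≤ volume C := by
        refine measure_mono (union_subset ?_ ?_)
        · rintro _ ⟨x, hx, rfl⟩; exact h x hx b hb
        · rintro _ ⟨x, hx, rfl⟩; exact h a ha x hx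

/-- The one-dimensional Brunn–Minkowski inequality. -/
lemma volume_add_volume_le {A B C : Set ℝ} (hA : MeasurableSet A) (hB : MeasurableSet B)
    (hA' : A.Nonempty) (hB' : B.Nonempty) (h : ∀ a ∈ A, ∀ b ∈ B, a + b ∈ C) :
    volume A + volume B ≤ volume C := by
  obtain ⟨a, ha⟩ := hA'
  obtain ⟨b, hb⟩ := hB'
  rw [hA.measure_eq_iSup_isCompact, hB.measure_eq_iSup_isCompact]
  simp only [iSup_and']
  refine ENNReal.biSup_add_biSup_le' ⟨∅, by simp⟩ ⟨∅, by simp⟩ ?_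
  rintro K ⟨hKA, hK⟩ L ⟨hLB, hL⟩
  have := volume_add_volume_le_of_isCompact (C := C) (hK.insert a) (hL.insert b)
    (insert_nonempty _ _) (insert_nonempty _ _)
    (fun x hx y hy ↦ h x (insert_subset ha hKA hx) y (insert_subset hb hLB hy))
  exact (add_le_add (measure_mono (subset_insert _ _)) (measure_mono (subset_insert _ _))).trans this

lemma ENNReal.rpow_mul_rpow_le_add {l : ℝ} (hl0 : 0 < l) (hl1 : l < 1) (x y : ENNReal) :
    x ^ (1 - l) * y ^ l ≤ ENNReal.ofReal (1 - l) * x + ENNReal.ofReal l * y := by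
  by_cases hx : x = ⊤
  · simp [hx, ENNReal.mul_top, hl1]
  by_cases hy : y = ⊤
  · simp [hy, ENNReal.mul_top, hl0]
  lift x to NNReal using hx
  lift y to NNReal using hy
  have := NNReal.geom_mean_le_arith_mean2_weighted (1 - l).toNNReal l.toNNReal x y (by
    rw [← Real.toNNReal_add (by linarith) hl0.le]; simp)
  rw [Real.coe_toNNReal _ (by linarith), Real.coe_toNNReal _ hl0.le] at this
  rw [← ENNReal.coe_rpow_of_nonneg _ (by linarith), ← ENNReal.coe_rpow_of_nonneg _ hl0.le]
  unfold ENNReal.ofReal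
  exact_mod_cast this

open scoped Pointwise in
lemma prekopa_leindler_of_isLUB_one {g₁ g₂ h : ℝ → ℝ} {l : ℝ} (hl0 : 0 < l) (hl1 : l < 1)
    (hg₁ : Measurable g₁) (hg₂ : Measurable g₂) (hh : Measurable h)
    (hg₁0 : ∀ x, 0 ≤ g₁ x) (hg₂0 : ∀ x, 0 ≤ g₂ x) (hh0 : ∀ x, 0 ≤ h x)
    (hs₁ : IsLUB (range g₁) 1) (hs₂ : IsLUB (range g₂) 1)
    (H : ∀ x y, g₁ x ^ (1 - l) * g₂ y ^ l ≤ h ((1 - l) * x + l * y)) :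
    ENNReal.ofReal (1 - l) * (∫⁻ x, ENNReal.ofReal (g₁ x)) +
      ENNReal.ofReal l * (∫⁻ x, ENNReal.ofReal (g₂ x)) ≤ ∫⁻ x, ENNReal.ofReal (h x) := by
  have hmeas : ∀ g : ℝ → ℝ, Measurable fun t : ℝ ↦ volume {x | t < g x} := fun g ↦
    Antitone.measurable fun s t hst ↦ measure_mono fun x hx ↦ hst.trans_lt hx
  rw [lintegral_eq_lintegral_meas_lt _ (.of_forall hg₁0) hg₁.aemeasurable,
    lintegral_eq_lintegral_meas_lt _ (.of_forall hg₂0) hg₂.aemeasurable,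
    lintegral_eq_lintegral_meas_lt _ (.of_forall hh0) hh.aemeasurable,
    ← lintegral_const_mul _ (hmeas _), ← lintegral_const_mul _ (hmeas _),
    ← lintegral_add_left ((hmeas _).const_mul _)]
  refine setLIntegral_mono (hmeas _) fun t (ht : 0 < t) ↦ ?_
  rcases le_or_gt 1 t with ht1 | ht1
  · have h1 : {x | t < g₁ x} = ∅ := by
      ext x; simpa using (hs₁.1 ⟨x, rfl⟩).trans ht1
    have h2 : {x | t < g₂ x} = ∅ := by
      ext x; simpa using (hs₂.1 ⟨x, rfl⟩).trans ht1
    simp [h1, h2]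
  obtain ⟨_, ⟨x₁, rfl⟩, hx₁, -⟩ := hs₁.exists_between ht1
  obtain ⟨_, ⟨x₂, rfl⟩, hx₂, -⟩ := hs₂.exists_between ht1
  have hl1' : 0 < 1 - l := by linarith
  have key := volume_add_volume_le (A := (1 - l) • {x | t < g₁ x}) (B := l • {x | t < g₂ x})
    (C := {x | t < h x}) ((measurableSet_lt measurable_const hg₁).const_smul₀ _)
    ((measurableSet_lt measurable_const hg₂).const_smul₀ _)
    (Set.Nonempty.smul_set ⟨x₁, hx₁⟩) (Set.Nonempty.smul_set ⟨x₂, hx₂⟩) (by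
      rintro _ ⟨x, hx, rfl⟩ _ ⟨y, hy, rfl⟩
      refine lt_of_lt_of_le ?_ (H x y)
      calc t = t ^ (1 - l) * t ^ l := by rw [← Real.rpow_add ht]; simp
        _ < g₁ x ^ (1 - l) * g₂ y ^ l :=
          mul_lt_mul'' (Real.rpow_lt_rpow ht.le hx hl1') (Real.rpow_lt_rpow ht.le hy hl0)
            (by positivity) (by positivity))
  simpa [Measure.addHaar_smul, abs_of_pos hl0, abs_of_pos hl1'] using key

lemma prekopa_leindler_of_bddAbove {g₁ g₂ h : ℝ → ℝ} {l : ℝ} (hl0 : 0 < l) (hl1 : l < 1)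
    (hg₁ : Measurable g₁) (hg₂ : Measurable g₂) (hh : Measurable h)
    (hg₁0 : ∀ x, 0 ≤ g₁ x) (hg₂0 : ∀ x, 0 ≤ g₂ x) (hh0 : ∀ x, 0 ≤ h x)
    (hs₁ : BddAbove (range g₁)) (hs₂ : BddAbove (range g₂))
    (H : ∀ x y, g₁ x ^ (1 - l) * g₂ y ^ l ≤ h ((1 - l) * x + l * y)) :
    (∫⁻ x, ENNReal.ofReal (g₁ x)) ^ (1 - l) * (∫⁻ x, ENNReal.ofReal (g₂ x)) ^ l ≤
      ∫⁻ x, ENNReal.ofReal (h x) := by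
  have hl1' : 0 < 1 - l := by linarith
  by_cases hz₁ : ∀ x, g₁ x = 0
  · simp [hz₁, hl1]
  by_cases hz₂ : ∀ x, g₂ x = 0
  · simp [hz₂, hl0]
  push Not at hz₁ hz₂
  have hpos : ∀ g : ℝ → ℝ, (∀ x, 0 ≤ g x) → (∃ x, g x ≠ 0) → BddAbove (range g) →
      0 < sSup (range g) := fun g hg ⟨x, hx⟩ hb ↦
    ((hg x).lt_of_ne' hx).trans_le (le_csSup hb ⟨x, rfl⟩)
  set a := sSup (range g₁) with ha
  set b := sSup (range g₂) with hb
  have ha0 : 0 < a := hpos _ hg₁0 hz₁ hs₁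
  have hb0 : 0 < b := hpos _ hg₂0 hz₂ hs₂
  have hlub : ∀ g : ℝ → ℝ, BddAbove (range g) → 0 < sSup (range g) →
      IsLUB (range fun x ↦ (sSup (range g))⁻¹ * g x) 1 := by
    intro g hg hg0
    have := (isLUB_csSup (range_nonempty g) hg).mul_left (a := (sSup (range g))⁻¹) (by positivity)
    rw [inv_mul_cancel₀ hg0.ne', ← range_comp] at this
    exact this
  have key := prekopa_leindler_of_isLUB_one (h := fun x ↦ (a ^ (1 - l) * b ^ l)⁻¹ * h x) hl0 hl1
    (hg₁.const_mul a⁻¹) (hg₂.const_mul b⁻¹) (hh.const_mul _)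
    (fun x ↦ mul_nonneg (by positivity) (hg₁0 x)) (fun x ↦ mul_nonneg (by positivity) (hg₂0 x))
    (fun x ↦ mul_nonneg (by positivity) (hh0 x)) (hlub _ hs₁ ha0) (hlub _ hs₂ hb0) (by
      intro x y
      rw [Real.mul_rpow (by positivity) (hg₁0 x), Real.mul_rpow (by positivity) (hg₂0 y),
        Real.inv_rpow ha0.le, Real.inv_rpow hb0.le, mul_inv]
      calc _ = ((a ^ (1 - l))⁻¹ * (b ^ l)⁻¹) * (g₁ x ^ (1 - l) * g₂ y ^ l) := by ring
        _ ≤ _ := mul_le_mul_of_nonneg_left (H x y) (by positivity))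
  have key2 := (ENNReal.rpow_mul_rpow_le_add hl0 hl1 _ _).trans key
  have hc : 0 < (a ^ (1 - l) * b ^ l)⁻¹ := by positivity
  simp_rw [ENNReal.ofReal_mul (inv_nonneg.2 ha0.le), ENNReal.ofReal_mul (inv_nonneg.2 hb0.le),
    ENNReal.ofReal_mul hc.le] at key2
  rw [lintegral_const_mul _ hg₁.ennreal_ofReal, lintegral_const_mul _ hg₂.ennreal_ofReal,
    lintegral_const_mul _ hh.ennreal_ofReal, ENNReal.mul_rpow_of_nonneg _ _ hl1'.le,
    ENNReal.mul_rpow_of_nonneg _ _ hl0.le, ENNReal.ofReal_rpow_of_pos (by positivity),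
    ENNReal.ofReal_rpow_of_pos (by positivity), mul_mul_mul_comm,
    ← ENNReal.ofReal_mul (by positivity), Real.inv_rpow ha0.le, Real.inv_rpow hb0.le,
    ← mul_inv] at key2
  exact (ENNReal.mul_le_mul_iff_right (by simpa using hc) ENNReal.ofReal_ne_top).1 key2

/-- The one-dimensional Prékopa–Leindler inequality. -/
lemma prekopa_leindler {g₁ g₂ h : ℝ → ℝ} {l : ℝ} (hl0 : 0 < l) (hl1 : l < 1)
    (hg₁ : Measurable g₁) (hg₂ : Measurable g₂) (hh : Measurable h)
    (hg₁0 : ∀ x, 0 ≤ g₁ x) (hg₂0 : ∀ x, 0 ≤ g₂ x) (hh0 : ∀ x, 0 ≤ h x)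
    (H : ∀ x y, g₁ x ^ (1 - l) * g₂ y ^ l ≤ h ((1 - l) * x + l * y)) :
    (∫⁻ x, ENNReal.ofReal (g₁ x)) ^ (1 - l) * (∫⁻ x, ENNReal.ofReal (g₂ x)) ^ l ≤
      ∫⁻ x, ENNReal.ofReal (h x) := by
  have hl1' : 0 < 1 - l := by linarith
  have hlim : ∀ g : ℝ → ℝ, Measurable g →
      ∫⁻ x, ENNReal.ofReal (g x) = ⨆ n : ℕ, ∫⁻ x, ENNReal.ofReal (min (g x) n) := by
    intro g hg
    rw [← lintegral_iSup (fun n ↦ (hg.min measurable_const).ennreal_ofReal)]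
    · refine lintegral_congr fun x ↦ le_antisymm ?_ (iSup_le fun n ↦ ENNReal.ofReal_le_ofReal
        (min_le_left _ _))
      obtain ⟨n, hn⟩ := exists_nat_ge (g x)
      exact le_iSup_of_le n (by rw [min_eq_left hn])
    · intro m n hmn x
      exact ENNReal.ofReal_le_ofReal (min_le_min_left _ (by exact_mod_cast hmn))
  have hmono : ∀ g : ℝ → ℝ, Monotone fun n : ℕ ↦ ∫⁻ x, ENNReal.ofReal (min (g x) n) :=
    fun g m n hmn ↦ lintegral_mono fun x ↦
      ENNReal.ofReal_le_ofReal (min_le_min_left _ (by exact_mod_cast hmn))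
  have hpow : ∀ (p : ℝ), 0 < p → ∀ u : ℕ → ENNReal, (⨆ n, u n) ^ p = ⨆ n, u n ^ p :=
    fun p hp u ↦ (ENNReal.orderIsoRpow p hp).map_iSup u
  rw [hlim g₁ hg₁, hlim g₂ hg₂, hpow _ hl1', hpow _ hl0]
  simp only [ENNReal.iSup_mul, ENNReal.mul_iSup]
  refine iSup_le fun j ↦ iSup_le fun i ↦ ?_
  set n := max i j
  refine (mul_le_mul' (ENNReal.rpow_le_rpow (hmono g₁ (le_max_left i j)) hl1'.le)
    (ENNReal.rpow_le_rpow (hmono g₂ (le_max_right i j)) hl0.le)).trans ?_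
  refine prekopa_leindler_of_bddAbove hl0 hl1 (hg₁.min measurable_const)
    (hg₂.min measurable_const) hh (fun x ↦ le_min (hg₁0 x) n.cast_nonneg)
    (fun x ↦ le_min (hg₂0 x) n.cast_nonneg) hh0 ⟨n, ?_⟩ ⟨n, ?_⟩ fun x y ↦ le_trans ?_ (H x y)
  · rintro _ ⟨x, rfl⟩; exact min_le_right _ _
  · rintro _ ⟨x, rfl⟩; exact min_le_right _ _
  · exact mul_le_mul (Real.rpow_le_rpow (le_min (hg₁0 x) n.cast_nonneg) (min_le_left _ _) hl1'.le)
      (Real.rpow_le_rpow (le_min (hg₂0 y) n.cast_nonneg) (min_le_left _ _) hl0.le)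
      (Real.rpow_nonneg (le_min (hg₂0 y) n.cast_nonneg) _) (Real.rpow_nonneg (hg₁0 x) _)

/-- A convex set in a finite-dimensional space is weakly separated from any point outside it. -/
lemma Convex.exists_ne_zero_forall_le {V : Type*} [NormedAddCommGroup V] [NormedSpace ℝ V]
    [FiniteDimensional ℝ V] {A : Set V} (hA : Convex ℝ A) (hne : A.Nonempty) {x : V}
    (hx : x ∉ A) : ∃ φ : V →L[ℝ] ℝ, φ ≠ 0 ∧ ∀ a ∈ A, φ a ≤ φ x := by
  by_cases hA' : (interior A).Nonempty
  · exact geometric_hahn_banach_of_nonempty_interior_point hA (fun h ↦ hx (interior_subset h)) hA'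
  rw [hA.interior_nonempty_iff_affineSpan_eq_top] at hA'
  obtain ⟨a₀, ha₀⟩ := hne
  have hdir : (affineSpan ℝ A).direction < ⊤ := by
    refine lt_top_iff_ne_top.2 fun h ↦ hA' ?_
    exact (AffineSubspace.direction_eq_top_iff_of_nonempty
      ⟨a₀, subset_affineSpan ℝ A ha₀⟩).1 h
  obtain ⟨φ, hφ, hker⟩ := Submodule.exists_le_ker_of_lt_top _ hdir
  have hconst : ∀ a ∈ A, φ a = φ a₀ := fun a ha ↦ by
    have : φ (a - a₀) = 0 := hker (AffineSubspace.vsub_mem_direction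
      (subset_affineSpan ℝ A ha) (subset_affineSpan ℝ A ha₀))
    rwa [map_sub, sub_eq_zero] at this
  rcases le_total (φ a₀) (φ x) with h | h
  · exact ⟨LinearMap.toContinuousLinearMap φ, by simpa using hφ,
      fun a ha ↦ by simpa [hconst a ha] using h⟩
  · exact ⟨-LinearMap.toContinuousLinearMap φ, by simpa using hφ,
      fun a ha ↦ by simpa [hconst a ha] using h⟩

/-- If the tails of a density on `ℝ` decay at rate `b`, its first moment is controlled. -/
lemma mul_integral_le_of_tail_le {g : ℝ → ℝ} {A b : ℝ} (hA : 0 < A) (hb : 0 < b)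
    (hgm : Measurable g) (hg0 : ∀ s, 0 ≤ g s) (hg : Integrable g)
    (hsg : Integrable fun s ↦ s * g s)
    (htail : ∀ s, ∫⁻ r in Ioi s, ENNReal.ofReal (g r) ≤ ENNReal.ofReal (A * rexp (-b * s))) :
    b * ∫ s, s * g s ≤ (∫ s, g s) * (1 + log A - log (∫ s, g s)) := by
  set m := ∫ s, g s with hm
  have hmnn : 0 ≤ m := integral_nonneg hg0
  rcases hmnn.eq_or_lt with h0 | hm0
  · have h1 : g =ᵐ[volume] 0 := (integral_eq_zero_iff_of_nonneg hg0 hg).1 h0.symm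
    have h2 : ∫ s, s * g s = 0 := by
      refine integral_eq_zero_of_ae ?_
      filter_upwards [h1] with s hs
      simp [hs]
    simp [h2, ← h0]
  set s₀ := (log A - log m) / b with hs₀
  have hbs₀ : b * s₀ = log A - log m := by rw [hs₀]; field_simp
  have hexp : A * rexp (-b * s₀) = m := by
    rw [neg_mul, hbs₀, neg_sub, Real.exp_sub, exp_log hA, exp_log hm0]; field_simp
  have hlin : ∫⁻ s, ENNReal.ofReal (max (s - s₀) 0 * g s) ≤ ENNReal.ofReal (m / b) := by
    have hmax : Measurable fun s : ℝ ↦ max (s - s₀) 0 := by fun_prop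
    calc ∫⁻ s, ENNReal.ofReal (max (s - s₀) 0 * g s)
        = ∫⁻ s, ENNReal.ofReal (max (s - s₀) 0)
            ∂(volume.withDensity fun s ↦ ENNReal.ofReal (g s)) := by
          rw [lintegral_withDensity_eq_lintegral_mul _ hgm.ennreal_ofReal hmax.ennreal_ofReal]
          refine lintegral_congr fun s ↦ ?_
          rw [ENNReal.ofReal_mul (le_max_right _ _), Pi.mul_apply, mul_comm]
      _ = ∫⁻ t in Ioi 0, ∫⁻ r in Ioi (s₀ + t), ENNReal.ofReal (g r) := by
          rw [lintegral_eq_lintegral_meas_lt (f := fun s ↦ max (s - s₀) 0) _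
            (.of_forall fun _ ↦ le_max_right _ _)
            hmax.aemeasurable]
          refine setLIntegral_congr_fun measurableSet_Ioi fun t (ht : 0 < t) ↦ ?_
          have : {a : ℝ | t < max (a - s₀) 0} = Ioi (s₀ + t) := by
            ext a
            simp only [mem_ofPred_eq, lt_max_iff, mem_Ioi, ht.not_gt, or_false]
            constructor <;> intro h <;> linarith
          simp only [this]
          rw [withDensity_apply _ measurableSet_Ioi]
      _ ≤ ∫⁻ t in Ioi 0, ENNReal.ofReal (m * rexp (-b * t)) := by
          refine lintegral_mono fun t ↦ (htail _).trans_eq ?_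
          rw [mul_add, Real.exp_add, ← mul_assoc, hexp]
      _ = ENNReal.ofReal (m / b) := by
          rw [← ofReal_integral_eq_lintegral_ofReal
            ((integrableOn_exp_mul_Ioi (by linarith) 0).const_mul m)
            (.of_forall fun t ↦ by positivity), integral_const_mul,
            integral_exp_mul_Ioi (by linarith)]
          simp [div_eq_mul_inv]
  have hdiff : Integrable fun s ↦ (s - s₀) * g s := by
    simp_rw [sub_mul]
    exact hsg.sub (hg.const_mul _)
  have hle : ∫ s, (s - s₀) * g s ≤ m / b := by
    have hmax : Integrable fun s ↦ max (s - s₀) 0 * g s := by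
      refine hdiff.abs.mono' (by fun_prop) (.of_forall fun s ↦ ?_)
      rw [Real.norm_eq_abs, abs_mul, abs_mul]
      refine mul_le_mul_of_nonneg_right ?_ (abs_nonneg _)
      rw [abs_of_nonneg (le_max_right _ _)]
      exact max_le (le_abs_self _) (abs_nonneg _)
    have hnn : ∀ s, 0 ≤ max (s - s₀) 0 * g s := fun s ↦ mul_nonneg (le_max_right _ _) (hg0 s)
    refine (integral_mono hdiff hmax
      fun s ↦ mul_le_mul_of_nonneg_right (le_max_left _ _) (hg0 s)).trans ?_
    rw [integral_eq_lintegral_of_nonneg_ae (.of_forall hnn) hmax.aestronglyMeasurable]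
    exact ENNReal.toReal_le_of_le_ofReal (by positivity) hlin
  have heq : ∫ s, (s - s₀) * g s = (∫ s, s * g s) - s₀ * m := by
    simp_rw [sub_mul]
    rw [integral_sub hsg (hg.const_mul _), integral_const_mul]
  rw [heq] at hle
  have : b * ((∫ s, s * g s) - s₀ * m) ≤ m := by
    calc _ ≤ b * (m / b) := mul_le_mul_of_nonneg_left hle hb.le
      _ = m := by field_simp
  nlinarith [hbs₀]

/-- A nonnegative function is log-concave if it is at least the weighted geometric mean of its
values at two points on the segment joining them. -/
def LogConcave {V : Type*} [AddCommGroup V] [Module ℝ V] (f : V → ℝ) : Prop :=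
  (∀ x, 0 ≤ f x) ∧ ∀ x y : V, ∀ l : ℝ, 0 ≤ l → l ≤ 1 →
    f x ^ (1 - l) * f y ^ l ≤ f ((1 - l) • x + l • y)

lemma LogConcave.convex_lt {V : Type*} [AddCommGroup V] [Module ℝ V] {f : V → ℝ}
    (hf : LogConcave f) (t : ℝ) : Convex ℝ {x | t < f x} := by
  intro x hx y hy a b ha hb hab
  obtain rfl : a = 1 - b := by linarith
  rcases lt_or_ge t 0 with ht | ht
  · exact ht.trans_le (hf.1 _)
  have hx' : t < f x := hx
  have hy' : t < f y := hy
  refine (lt_min hx' hy').trans_le (le_trans ?_ (hf.2 x y b hb (by linarith)))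
  have hc : 0 < min (f x) (f y) := lt_min (ht.trans_lt hx') (ht.trans_lt hy')
  calc min (f x) (f y) = min (f x) (f y) ^ (1 - b) * min (f x) (f y) ^ b := by
        rw [← Real.rpow_add hc]; simp
    _ ≤ f x ^ (1 - b) * f y ^ b := by
        gcongr
        · exact Real.rpow_nonneg (hf.1 x) _
        · exact min_le_left _ _
        · exact min_le_right _ _

lemma LogConcave.measurable {g : ℝ → ℝ} (hg : LogConcave g) : Measurable g :=
  measurable_of_Ioi fun t ↦ (hg.convex_lt t).ordConnected.measurableSet

lemma LogConcave.comp_linearMap {V W : Type*} [AddCommGroup V] [Module ℝ V] [AddCommGroup W]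
    [Module ℝ W] {f : W → ℝ} (hf : LogConcave f) (L : V →ₗ[ℝ] W) :
    LogConcave fun x ↦ f (L x) :=
  ⟨fun x ↦ hf.1 _, fun x y l h0 h1 ↦ by simpa using hf.2 (L x) (L y) l h0 h1⟩

section Product

variable {E : Type*} [NormedAddCommGroup E] [NormedSpace ℝ E]

lemma LogConcave.line {f : E × ℝ → ℝ} (hf : LogConcave f) (y : E) :
    LogConcave fun s ↦ f (y, s) := by
  refine ⟨fun x ↦ hf.1 _, fun x z l h0 h1 ↦ (hf.2 (y, x) (y, z) l h0 h1).trans_eq ?_⟩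
  simp [← add_smul]

/-- The integral of `f` over the vertical half-line above a point. -/
noncomputable def upperTail (f : E × ℝ → ℝ) (x : E × ℝ) : ENNReal :=
  ∫⁻ r in Ioi x.2, ENNReal.ofReal (f (x.1, r))

lemma LogConcave.upperTail_mul_le {f : E × ℝ → ℝ} (hf : LogConcave f) (x y : E × ℝ) {l : ℝ}
    (hl0 : 0 < l) (hl1 : l < 1) :
    upperTail f x ^ (1 - l) * upperTail f y ^ l ≤ upperTail f ((1 - l) • x + l • y) := by
  have hind : ∀ z : E × ℝ, upperTail f z =
      ∫⁻ r, ENNReal.ofReal ((Ioi z.2).indicator (fun r ↦ f (z.1, r)) r) := fun z ↦ by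
    rw [upperTail, ← lintegral_indicator measurableSet_Ioi]
    refine lintegral_congr fun r ↦ ?_
    by_cases hr : r ∈ Ioi z.2 <;> simp [hr]
  have hm : ∀ z : E × ℝ, Measurable ((Ioi z.2).indicator fun r ↦ f (z.1, r)) := fun z ↦
    (hf.line z.1).measurable.indicator measurableSet_Ioi
  have hnn : ∀ (z : E × ℝ) (r : ℝ), 0 ≤ (Ioi z.2).indicator (fun r ↦ f (z.1, r)) r :=
    fun z r ↦ indicator_nonneg (fun r _ ↦ hf.1 _) r
  have hl1' : 0 < 1 - l := by linarith
  simp_rw [hind]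
  refine prekopa_leindler hl0 hl1 (hm x) (hm y) (hm _) (hnn x) (hnn y) (hnn _) fun r q ↦ ?_
  by_cases hr : r ∈ Ioi x.2
  · by_cases hq : q ∈ Ioi y.2
    · have hrq : (1 - l) * r + l * q ∈ Ioi ((1 - l) • x + l • y).2 := by
        simp only [mem_Ioi, Prod.snd_add, Prod.smul_snd, smul_eq_mul] at *
        exact add_lt_add (mul_lt_mul_of_pos_left hr hl1') (mul_lt_mul_of_pos_left hq hl0)
      rw [indicator_of_mem hr, indicator_of_mem hq, indicator_of_mem hrq]
      exact hf.2 (x.1, r) (y.1, q) l hl0.le hl1.le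
    · rw [indicator_of_notMem hq, Real.zero_rpow hl0.ne', mul_zero]
      exact hnn _ _
  · rw [indicator_of_notMem hr, Real.zero_rpow hl1'.ne', zero_mul]
    exact hnn _ _

lemma LogConcave.lintegral_line_mul_le {f : E × ℝ → ℝ} (hf : LogConcave f) (x y : E) {l : ℝ}
    (hl0 : 0 < l) (hl1 : l < 1) :
    (∫⁻ r, ENNReal.ofReal (f (x, r))) ^ (1 - l) * (∫⁻ r, ENNReal.ofReal (f (y, r))) ^ l ≤
      ∫⁻ r, ENNReal.ofReal (f ((1 - l) • x + l • y, r)) :=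
  prekopa_leindler hl0 hl1 (hf.line x).measurable (hf.line y).measurable (hf.line _).measurable
    (fun _ ↦ hf.1 _) (fun _ ↦ hf.1 _) (fun _ ↦ hf.1 _)
    fun r q ↦ hf.2 (x, r) (y, q) l hl0.le hl1.le

lemma LogConcave.convex_lt_upperTail {f : E × ℝ → ℝ} (hf : LogConcave f) :
    Convex ℝ {z : (E × ℝ) × ℝ | ENNReal.ofReal (rexp z.2) < upperTail f z.1} := by
  refine convex_iff_forall_pos.2 ?_
  rintro ⟨x, r⟩ hx ⟨y, q⟩ hy a b ha hb hab
  obtain rfl : a = 1 - b := by linarith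
  refine lt_of_lt_of_le ?_ (hf.upperTail_mul_le x y hb (by linarith))
  have : ENNReal.ofReal (rexp ((1 - b) • (x, r) + b • (y, q)).2) =
      ENNReal.ofReal (rexp r) ^ (1 - b) * ENNReal.ofReal (rexp q) ^ b := by
    rw [ENNReal.ofReal_rpow_of_pos (exp_pos _), ENNReal.ofReal_rpow_of_pos (exp_pos _),
      ← ENNReal.ofReal_mul (by positivity), ← Real.exp_mul, ← Real.exp_mul, ← Real.exp_add]
    congr 2
    simp [mul_comm]
  rw [this]
  exact ENNReal.mul_lt_mul (ENNReal.rpow_lt_rpow hx ha) (ENNReal.rpow_lt_rpow hy hb)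

lemma LogConcave.convex_upperTail_pos {f : E × ℝ → ℝ} (hf : LogConcave f) :
    Convex ℝ {z : E × ℝ | 0 < upperTail f z} := by
  refine convex_iff_forall_pos.2 fun x hx y hy a b ha hb hab ↦ ?_
  obtain rfl : a = 1 - b := by linarith
  refine lt_of_lt_of_le ?_ (hf.upperTail_mul_le x y hb (by linarith))
  exact ENNReal.mul_pos (ENNReal.rpow_pos_of_nonneg hx ha.le).ne'
    (ENNReal.rpow_pos_of_nonneg hy hb.le).ne'

lemma LogConcave.upperTail_pos_of_mem_interior {f : E × ℝ → ℝ} (hf : LogConcave f) {x : E × ℝ}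
    (hx : x ∈ interior {x | 0 < f x}) : 0 < upperTail f x := by
  have hcont : Continuous fun s : ℝ ↦ (x.1, s) := by fun_prop
  have hopen : {s : ℝ | (x.1, s) ∈ interior {x | 0 < f x}} ∈ nhds x.2 :=
    (isOpen_interior.preimage hcont).mem_nhds hx
  obtain ⟨u, hu, hsub⟩ := exists_Ico_subset_of_mem_nhds hopen ⟨x.2 + 1, by linarith⟩
  rw [upperTail, setLIntegral_pos_iff (hf.line x.1).measurable.ennreal_ofReal]
  refine lt_of_lt_of_le ?_ (measure_mono (s := Ioo x.2 u) fun s hs ↦ ⟨?_, hs.1⟩)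
  · simpa using hu
  · have hs' : (x.1, s) ∈ interior {x | 0 < f x} := hsub ⟨hs.1.le, hs.2⟩
    have : 0 < f (x.1, s) := (interior_subset hs' : (x.1, s) ∈ {x | 0 < f x})
    simpa [Function.mem_support] using this

variable [FiniteDimensional ℝ E] [MeasurableSpace E] [BorelSpace E] {μ : Measure E}
  [μ.IsAddHaarMeasure]

/-- A linear functional with zero integral against a log-concave density vanishes if it is
nonpositive where the vertical tails are positive. -/
lemma LogConcave.eq_zero_of_forall_upperTail_pos {f : E × ℝ → ℝ} (hf : LogConcave f)
    (hpos : 0 < ∫ x, f x ∂(μ.prod volume)) {u : E × ℝ →L[ℝ] ℝ}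
    (hui : Integrable (fun x ↦ u x * f x) (μ.prod volume))
    (hu0 : ∫ x, u x * f x ∂(μ.prod volume) = 0) (hu : ∀ x, 0 < upperTail f x → u x ≤ 0) :
    u = 0 := by
  by_contra hne
  have hae : ∀ᵐ x ∂(μ.prod volume), u x * f x ≤ 0 := by
    have hfr := (hf.convex_lt 0).addHaar_frontier (μ.prod volume)
    filter_upwards [measure_eq_zero_iff_ae_notMem.1 hfr] with x hx
    rcases (hf.1 x).eq_or_lt with h0 | h0
    · simp [← h0]
    · refine mul_nonpos_of_nonpos_of_nonneg (hu x (hf.upperTail_pos_of_mem_interior ?_)) h0.le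
      by_contra hx'
      exact hx ⟨subset_closure h0, hx'⟩
  have hzero : ∀ᵐ x ∂(μ.prod volume), u x * f x = 0 := by
    have h1 : ∫ x, -(u x * f x) ∂(μ.prod volume) = 0 := by rw [integral_neg, hu0, neg_zero]
    have h2 := (integral_eq_zero_iff_of_nonneg_ae (by
      filter_upwards [hae] with x hx; simpa using hx) hui.neg).1 h1
    filter_upwards [h2] with x hx
    simpa using hx
  have hker : (μ.prod volume) (LinearMap.ker u.toLinearMap : Set (E × ℝ)) = 0 := by
    refine Measure.addHaar_submodule _ _ fun h ↦ hne ?_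
    refine ContinuousLinearMap.ext fun x ↦ ?_
    have : x ∈ LinearMap.ker u.toLinearMap := h ▸ Submodule.mem_top
    simpa using this
  have hf0 : f =ᵐ[μ.prod volume] 0 := by
    filter_upwards [hzero, measure_eq_zero_iff_ae_notMem.1 hker] with x hx hx'
    have : u x ≠ 0 := by simpa using hx'
    simpa [this] using hx
  rw [integral_eq_zero_of_ae hf0] at hpos
  exact hpos.false

lemma LogConcave.upperTail_zero_pos {f : E × ℝ → ℝ} (hf : LogConcave f)
    (hpos : 0 < ∫ x, f x ∂(μ.prod volume))
    (hui : ∀ u : E × ℝ →L[ℝ] ℝ, Integrable (fun x ↦ u x * f x) (μ.prod volume))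
    (hu0 : ∀ u : E × ℝ →L[ℝ] ℝ, ∫ x, u x * f x ∂(μ.prod volume) = 0) :
    0 < upperTail f 0 := by
  by_contra h0
  have hne : {z : E × ℝ | 0 < upperTail f z}.Nonempty := by
    by_contra hempty
    rw [not_nonempty_iff_eq_empty, eq_empty_iff_forall_notMem] at hempty
    have := hf.eq_zero_of_forall_upperTail_pos hpos (hui (ContinuousLinearMap.snd ℝ E ℝ)) (hu0 _)
      fun x hx ↦ (hempty x hx).elim
    simpa using DFunLike.congr_fun this (0, 1)
  obtain ⟨u, hu, hle⟩ := hf.convex_upperTail_pos.exists_ne_zero_forall_le hne h0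
  exact hu (hf.eq_zero_of_forall_upperTail_pos hpos (hui u) (hu0 u)
    fun x hx ↦ (hle x hx).trans_eq (map_zero u))

/-- The vertical tails of a log-concave function with barycenter at the origin have an exponential
majorant which is tight at the origin. -/
lemma LogConcave.exists_upperTail_le_exp {f : E × ℝ → ℝ} (hf : LogConcave f)
    (hpos : 0 < ∫ x, f x ∂(μ.prod volume))
    (hui : ∀ u : E × ℝ →L[ℝ] ℝ, Integrable (fun x ↦ u x * f x) (μ.prod volume))
    (hu0 : ∀ u : E × ℝ →L[ℝ] ℝ, ∫ x, u x * f x ∂(μ.prod volume) = 0)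
    {a : ℝ} (ha : 0 < a) (hfa : upperTail f 0 = ENNReal.ofReal a) :
    ∃ u : E × ℝ →L[ℝ] ℝ, ∀ x, upperTail f x ≤ ENNReal.ofReal (a * rexp (u x)) := by
  have hnot : ((0 : E × ℝ), log a) ∉
      {z : (E × ℝ) × ℝ | ENNReal.ofReal (rexp z.2) < upperTail f z.1} := by
    simp [exp_log ha, hfa]
  have hmem : ((0 : E × ℝ), log a - 1) ∈
      {z : (E × ℝ) × ℝ | ENNReal.ofReal (rexp z.2) < upperTail f z.1} := by
    simp only [mem_ofPred_eq, hfa, ENNReal.ofReal_lt_ofReal_iff ha]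
    calc rexp (log a - 1) < rexp (log a) := Real.exp_lt_exp.2 (by linarith)
      _ = a := exp_log ha
  obtain ⟨φ, hφ, hle⟩ := hf.convex_lt_upperTail.exists_ne_zero_forall_le ⟨_, hmem⟩ hnot
  set v : E × ℝ →L[ℝ] ℝ := φ.comp (ContinuousLinearMap.inl ℝ (E × ℝ) ℝ) with hv
  set c : ℝ := φ (0, 1) with hc
  have hdecomp : ∀ x r, φ (x, r) = v x + c * r := fun x r ↦ by
    have : ((x, r) : (E × ℝ) × ℝ) = (x, 0) + r • (0, 1) := by simp
    rw [this, map_add, map_smul, hc, smul_eq_mul, mul_comm r]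
    rfl
  have hle' : ∀ x r, ENNReal.ofReal (rexp r) < upperTail f x → v x + c * r ≤ c * log a := by
    intro x r hxr
    have := hle (x, r) hxr
    rwa [hdecomp, hdecomp, map_zero, zero_add] at this
  have hex : ∀ (x : E × ℝ) (q : ENNReal), q < upperTail f x →
      ∃ r, q < ENNReal.ofReal (rexp r) ∧ ENNReal.ofReal (rexp r) < upperTail f x := by
    intro x q hq
    obtain ⟨p, hqp, hp⟩ := ENNReal.lt_iff_exists_nnreal_btwn.1 hq
    have hp0 : (0 : ℝ) < p := by
      have : (0 : ENNReal) < p := (zero_le).trans_lt hqp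
      exact_mod_cast this
    refine ⟨log p, ?_, ?_⟩ <;> rwa [exp_log hp0, ENNReal.ofReal_coe_nnreal]
  have hc0 : 0 ≤ c := by
    have := hle' 0 _ hmem
    rw [map_zero] at this
    linarith
  rcases hc0.eq_or_lt with hc0 | hc0
  · refine (hφ ?_).elim
    have hv0 : v = 0 := hf.eq_zero_of_forall_upperTail_pos hpos (hui v) (hu0 v) fun x hx ↦ by
      obtain ⟨r, -, hr⟩ := hex x 0 hx
      simpa [← hc0] using hle' x r hr
    refine ContinuousLinearMap.ext fun ⟨x, r⟩ ↦ ?_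
    rw [hdecomp, hv0, ← hc0]
    simp
  · refine ⟨-(c⁻¹ • v), fun x ↦ ?_⟩
    by_contra! hlt
    obtain ⟨r, hr, hr'⟩ := hex x _ hlt
    have h1 := hle' x r hr'
    rw [ENNReal.ofReal_lt_ofReal_iff (exp_pos _), ← exp_log ha, ← Real.exp_add,
      Real.exp_lt_exp] at hr
    have h2 : c * (log a + (-(c⁻¹ • v)) x) < c * r := mul_lt_mul_of_pos_left hr hc0
    have h3 : c * (log a + (-(c⁻¹ • v)) x) = c * log a - v x := by
      simp; field_simp; ring
    linarith

lemma le_of_forall_rpow_le {k : ℕ} {L : ℝ}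
    (h : ∀ t : ℝ, 0 < t → t < 1 → 1 + t * L ≤ ((1 - t) ^ k)⁻¹) : L ≤ k := by
  by_contra! hlt
  have hL : 0 < L := k.cast_nonneg.trans_lt hlt
  set t : ℝ := min (1 / 2) ((L - k) / (2 * (k + 1) * L)) with ht
  have ht0 : 0 < t := lt_min (by norm_num) (div_pos (by linarith) (by positivity))
  have ht1 : t ≤ 1 / 2 := min_le_left _ _
  have ht2 : t * (2 * (k + 1) * L) ≤ L - k :=
    (le_div_iff₀ (by positivity)).1 (min_le_right _ _)
  have hpow : 0 < (1 - t) ^ k := pow_pos (by linarith) k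
  have h1 : (1 + t * L) * (1 - t) ^ k ≤ 1 := by
    have := mul_le_mul_of_nonneg_right (h t ht0 (by linarith)) hpow.le
    rwa [inv_mul_cancel₀ hpow.ne'] at this
  have h2 : 1 + (k : ℝ) * (-t) ≤ (1 - t) ^ k := by
    have := one_add_mul_le_pow (a := -t) (by linarith) k
    rwa [← sub_eq_add_neg] at this
  have h3 := (mul_le_mul_of_nonneg_left h2 (by positivity : 0 ≤ 1 + t * L)).trans h1
  have h4 : t * (L - k - k * L * t) ≤ 0 := by nlinarith
  have h5 : 0 < L - k - k * L * t := by
    have : 0 < t * L := by positivity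
    nlinarith
  have := mul_pos ht0 h5
  linarith

lemma mul_one_add_log_le_rpow_mul_rpow {m c t : ℝ} (hm : 0 ≤ m) (hc : 0 < c) (ht1 : t < 1) :
    m * (1 + t * (log c - log m)) ≤ m ^ (1 - t) * c ^ t := by
  rcases hm.eq_or_lt with rfl | hm
  · simp [Real.zero_rpow (by linarith : 1 - t ≠ 0)]
  have : m ^ (1 - t) * c ^ t = m * rexp (t * (log c - log m)) := by
    rw [Real.rpow_def_of_pos hm, Real.rpow_def_of_pos hc, ← Real.exp_add,
      show log m * (1 - t) + log c * t = log m + t * (log c - log m) by ring, Real.exp_add,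
      exp_log hm]
  rw [this]
  refine mul_le_mul_of_nonneg_left ?_ hm.le
  linarith [add_one_le_exp (t * (log c - log m))]

/-- Grünbaum's inequality for the fibers of a log-concave function on a product `E × ℝ`. -/
theorem LogConcave.integral_line_le {f : E × ℝ → ℝ} (hf : LogConcave f)
    (hfi : Integrable f (μ.prod volume)) (hpos : 0 < ∫ x, f x ∂(μ.prod volume))
    (hui : ∀ u : E × ℝ →L[ℝ] ℝ, Integrable (fun x ↦ u x * f x) (μ.prod volume))
    (hu0 : ∀ u : E × ℝ →L[ℝ] ℝ, ∫ x, u x * f x ∂(μ.prod volume) = 0) :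
    rexp (-(Module.finrank ℝ E + 1 : ℕ)) * ∫ s, f (0, s) ≤ ∫ s in Ioi 0, f (0, s) := by
  by_cases h0 : Integrable fun s ↦ f (0, s)
  swap
  · rw [integral_undef h0, mul_zero]
    exact integral_nonneg fun s ↦ hf.1 _
  set a := ∫ s in Ioi 0, f (0, s) with ha_def
  have hfa : upperTail f 0 = ENNReal.ofReal a :=
    (ofReal_integral_eq_lintegral_ofReal h0.integrableOn (.of_forall fun s ↦ hf.1 _)).symm
  have ha : 0 < a := by
    have := hf.upperTail_zero_pos hpos hui hu0
    rwa [hfa, ENNReal.ofReal_pos] at this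
  obtain ⟨u, hu⟩ := hf.exists_upperTail_le_exp hpos hui hu0 ha hfa
  set m : E → ℝ := fun y ↦ ∫ s, f (y, s) with hm
  set k := Module.finrank ℝ E with hk
  change rexp (-(k + 1 : ℕ)) * m 0 ≤ a
  have ham : a ≤ m 0 := setIntegral_le_integral h0 (.of_forall fun s ↦ hf.1 _)
  have hm0 : 0 < m 0 := ha.trans_le ham
  have hmnn : ∀ y, 0 ≤ m y := fun y ↦ integral_nonneg fun s ↦ hf.1 _
  have hofReal : ∀ y, Integrable (fun s ↦ f (y, s)) →
      ∫⁻ s, ENNReal.ofReal (f (y, s)) = ENNReal.ofReal (m y) := fun y hy ↦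
    (ofReal_integral_eq_lintegral_ofReal hy (.of_forall fun s ↦ hf.1 _)).symm
  have hdecomp : ∀ y s, u (y, s) = u (y, 0) + u (0, 1) * s := fun y s ↦ by
    have : ((y, s) : E × ℝ) = (y, 0) + s • (0, 1) := by simp
    rw [this, map_add, map_smul, smul_eq_mul, mul_comm s]
  rcases le_or_gt 0 (u (0, 1)) with hb | hb
  · have hma : m 0 ≤ a := by
      have hlim : Filter.Tendsto (fun n : ℕ ↦ ∫ s in Ioi (-(n : ℝ)), f (0, s)) Filter.atTop
          (nhds (m 0)) := by
        have := tendsto_setIntegral_of_monotone (f := fun s ↦ f ((0 : E), s)) (μ := volume)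
          (s := fun n : ℕ ↦ Ioi (-(n : ℝ))) (fun n ↦ measurableSet_Ioi)
          (fun i j hij ↦ Ioi_subset_Ioi (by simpa using hij)) h0.integrableOn
        have hU : ⋃ n : ℕ, Ioi (-(n : ℝ)) = univ := iUnion_eq_univ_iff.2 fun s ↦ by
          obtain ⟨n, hn⟩ := exists_nat_gt (-s)
          exact ⟨n, neg_lt.1 hn⟩
        rwa [hU, setIntegral_univ] at this
      refine le_of_tendsto' hlim fun n ↦ ?_
      refine (ENNReal.ofReal_le_ofReal_iff ha.le).1 ?_
      rw [ofReal_integral_eq_lintegral_ofReal h0.integrableOn (.of_forall fun s ↦ hf.1 _)]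
      refine (hu (0, -(n : ℝ))).trans (ENNReal.ofReal_le_ofReal ?_)
      refine mul_le_of_le_one_right ha.le (Real.exp_le_one_iff.2 ?_)
      rw [hdecomp, Prod.mk_zero_zero, map_zero, zero_add]
      exact mul_nonpos_of_nonneg_of_nonpos hb (by simp)
    refine (mul_le_of_le_one_left (hmnn 0) (Real.exp_le_one_iff.2 ?_)).trans hma
    exact neg_nonpos.2 (Nat.cast_nonneg _)
  set L := log (m 0) - log a - 1 with hL
  have hmi : Integrable m μ := hfi.integral_prod_left
  have hUi : Integrable (fun y ↦ ∫ s, u (y, s) * f (y, s)) μ := (hui u).integral_prod_left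
  have hU0 : ∫ y, (∫ s, u (y, s) * f (y, s)) ∂μ = 0 := by
    rw [← integral_prod _ (hui u), hu0 u]
  have hmint : 0 < ∫ y, m y ∂μ := by rwa [hm, ← integral_prod _ hfi]
  have hline : ∀ᵐ y ∂μ, Integrable fun s ↦ f (y, s) := hfi.prod_right_ae
  have hline' : ∀ᵐ y ∂μ, Integrable fun s ↦ s * f (y, s) :=
    (hui (ContinuousLinearMap.snd ℝ E ℝ)).prod_right_ae
  have key : ∀ t : ℝ, 0 < t → t < 1 → 1 + t * L ≤ ((1 - t) ^ k)⁻¹ := by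
    intro t ht0 ht1
    have ht1' : 0 < 1 - t := by linarith
    have hline'' : ∀ᵐ y ∂μ, Integrable fun s ↦ f ((1 - t) • y, s) := by
      rw [ae_iff] at hline ⊢
      have := Measure.addHaar_preimage_smul μ ht1'.ne' {y | ¬ Integrable fun s ↦ f (y, s)}
      rwa [hline, mul_zero] at this
    have hpt : ∀ᵐ y ∂μ, (1 + t * L) * m y - t * ∫ s, u (y, s) * f (y, s) ≤ m ((1 - t) • y) := by
      filter_upwards [hline, hline', hline''] with y hy hy' hy''
      have hprek : m y ^ (1 - t) * m 0 ^ t ≤ m ((1 - t) • y) := by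
        have := hf.lintegral_line_mul_le y 0 ht0 ht1
        rwa [smul_zero, add_zero, hofReal _ hy, hofReal _ h0, hofReal _ hy'',
          ENNReal.ofReal_rpow_of_nonneg (hmnn _) ht1'.le,
          ENNReal.ofReal_rpow_of_nonneg (hmnn _) ht0.le,
          ← ENNReal.ofReal_mul (Real.rpow_nonneg (hmnn _) _),
          ENNReal.ofReal_le_ofReal_iff (hmnn _)] at this
      have hmom := mul_integral_le_of_tail_le (A := a * rexp (u (y, 0))) (b := -u (0, 1))
        (by positivity) (by linarith) (hf.line y).measurable (fun s ↦ hf.1 _) hy hy' fun s ↦ by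
          refine (hu (y, s)).trans_eq ?_
          rw [hdecomp y s, Real.exp_add, neg_neg, mul_assoc]
      rw [log_mul ha.ne' (exp_pos _).ne', log_exp] at hmom
      have hU : ∫ s, u (y, s) * f (y, s) = u (y, 0) * m y + u (0, 1) * ∫ s, s * f (y, s) := by
        rw [hm, ← integral_const_mul, ← integral_const_mul,
          ← integral_add (hy.const_mul _) (hy'.const_mul _)]
        refine integral_congr_ae (.of_forall fun s ↦ ?_)
        simp only [hdecomp y s]
        ring
      have hlog := mul_one_add_log_le_rpow_mul_rpow (hmnn y) hm0 ht1
      have hmom' := mul_le_mul_of_nonneg_left hmom ht0.le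
      change t * _ ≤ t * (m y * (1 + (log a + u (y, 0)) - log (m y))) at hmom'
      rw [hU, hL]
      refine le_trans ?_ (hlog.trans hprek)
      linarith
    have hcomp : ∫ y, m ((1 - t) • y) ∂μ = ((1 - t) ^ k)⁻¹ * ∫ y, m y ∂μ := by
      rw [Measure.integral_comp_smul, smul_eq_mul, abs_of_pos (by positivity)]
    have hle := integral_mono_ae ((hmi.const_mul (1 + t * L)).sub (hUi.const_mul t))
      (hmi.comp_smul ht1'.ne') hpt
    rw [integral_sub' (hmi.const_mul _) (hUi.const_mul _), integral_const_mul, integral_const_mul,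
      hU0, mul_zero, sub_zero, hcomp] at hle
    exact le_of_mul_le_mul_right hle hmint
  have hLk : log (m 0) ≤ (k + 1 : ℕ) + log a := by
    have := le_of_forall_rpow_le key
    push_cast
    linarith
  calc rexp (-(k + 1 : ℕ)) * m 0 = rexp (-(k + 1 : ℕ) + log (m 0)) := by
        rw [Real.exp_add, exp_log hm0]
    _ ≤ rexp (log a) := Real.exp_le_exp.2 (by linarith)
    _ = a := exp_log ha

end Product

/-- A volume-preserving linear parametrization of `ℝᵏ⁺¹` by `ℝᵏ × ℝ` which maps the last coordinate
axis to the line spanned by a given unit vector. -/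
lemma exists_measurePreserving_prod {k : ℕ} (θ : EuclideanSpace ℝ (Fin (k + 1))) (hθ : ‖θ‖ = 1) :
    ∃ Φ : ((Fin k → ℝ) × ℝ) ≃L[ℝ] EuclideanSpace ℝ (Fin (k + 1)),
      MeasurePreserving Φ ∧ ∀ s : ℝ, Φ (0, s) = s • θ := by
  obtain ⟨b, hb⟩ := Orthonormal.exists_orthonormalBasis_extension_of_card_eq (𝕜 := ℝ)
    (E := EuclideanSpace ℝ (Fin (k + 1))) (ι := Fin (k + 1)) (by simp) (v := fun _ ↦ θ) (s := {0})
    (orthonormal_subsingleton_iff.2 fun _ ↦ hθ)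
  have hb0 : b 0 = θ := hb 0 rfl
  let e₁ : ((Fin k → ℝ) × ℝ) ≃L[ℝ] (Fin (k + 1) → ℝ) :=
    (ContinuousLinearEquiv.prodComm ℝ (Fin k → ℝ) ℝ).trans
      (Fin.consEquivL ℝ fun _ ↦ ℝ)
  have he₁ : MeasurePreserving e₁ := by
    convert! (volume_preserving_piFinSuccAbove (fun _ : Fin (k + 1) ↦ ℝ) 0).symm.comp
      Measure.measurePreserving_swap using 1
    ext x i
    refine Fin.cases ?_ (fun j ↦ ?_) i <;> simp [e₁, MeasurableEquiv.piFinSuccAbove]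
  refine ⟨(e₁.trans (EuclideanSpace.equiv _ ℝ).symm).trans
    b.repr.symm.toContinuousLinearEquiv, ?_, fun s ↦ ?_⟩
  · exact b.measurePreserving_repr_symm.comp
      ((PiLp.volume_preserving_toLp (Fin (k + 1))).comp he₁)
  · have : (EuclideanSpace.equiv (Fin (k + 1)) ℝ).symm (e₁ (0, s)) =
        s • EuclideanSpace.single 0 1 := by
      ext i
      refine Fin.cases ?_ (fun j ↦ ?_) i <;> simp [e₁]
    change b.repr.symm ((EuclideanSpace.equiv (Fin (k + 1)) ℝ).symm (e₁ (0, s))) = _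
    rw [this, map_smul, b.repr_symm_single, hb0]

/-- Generalized Grünbaum inequality: if `f : ℝⁿ → [0,∞)` is an integrable
log-concave function with positive total mass, finite first moment, and
center of mass at the origin, then for every unit vector `θ`,
`∫_0^∞ f(sθ) ds ≥ e^{-n} ∫_{-∞}^∞ f(sθ) ds`. -/
theorem generalized_grunbaum (n : ℕ) (hn : 1 ≤ n)
    (f : EuclideanSpace ℝ (Fin n) → ℝ)
    (hf_nonneg : ∀ x, 0 ≤ f x)
    (hf_logconcave : ∀ x y : EuclideanSpace ℝ (Fin n), ∀ l : ℝ, 0 ≤ l → l ≤ 1 →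
      f x ^ (1 - l) * f y ^ l ≤ f ((1 - l) • x + l • y))
    (hf_int : Integrable f)
    (hf_pos_mass : 0 < ∫ x, f x)
    (hf_moment : Integrable (fun x => ‖x‖ * f x))
    (hf_com : (∫ x, f x • x) = 0)
    (θ : EuclideanSpace ℝ (Fin n)) (hθ : ‖θ‖ = 1) :
    Real.exp (-(n : ℝ)) * ∫ s : ℝ, f (s • θ) ≤ ∫ s in Set.Ioi (0 : ℝ), f (s • θ) := by
  obtain ⟨k, rfl⟩ : ∃ k, n = k + 1 := ⟨n - 1, by omega⟩
  obtain ⟨Φ, hΦ, hΦθ⟩ := exists_measurePreserving_prod θ hθ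
  have hemb : MeasurableEmbedding Φ := Φ.toHomeomorph.measurableEmbedding
  have hmom : Integrable fun x ↦ f x • x := by
    refine hf_moment.mono (hf_int.1.smul aestronglyMeasurable_id) (.of_forall fun x ↦ ?_)
    simp [norm_smul, mul_comm]
  have hu (u : (Fin k → ℝ) × ℝ →L[ℝ] ℝ) : (fun x ↦ u x * f (Φ x)) =
      (fun x ↦ (u.comp (Φ.symm : EuclideanSpace ℝ (Fin (k + 1)) →L[ℝ] (Fin k → ℝ) × ℝ))
        (f x • x)) ∘ Φ := by
    ext x
    simp [mul_comm]
  have hmain := LogConcave.integral_line_le (μ := (volume : Measure (Fin k → ℝ)))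
    (f := fun x ↦ f (Φ x))
    (LogConcave.comp_linearMap ⟨hf_nonneg, hf_logconcave⟩ (Φ : (Fin k → ℝ) × ℝ →ₗ[ℝ] _))
    ((hΦ.integrable_comp_emb hemb).2 hf_int)
    (by rw [← Measure.volume_eq_prod, hΦ.integral_comp hemb]; exact hf_pos_mass)
    (fun u ↦ by
      rw [hu]
      exact (hΦ.integrable_comp_emb hemb).2 (ContinuousLinearMap.integrable_comp _ hmom))
    (fun u ↦ by
      rw [hu]
      refine (hΦ.integral_comp hemb _).trans
        ((ContinuousLinearMap.integral_comp_comm _ hmom).trans ?_)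
      rw [hf_com, map_zero])
  simpa only [hΦθ, Module.finrank_fin_fun] using hmain
end

section
/- Let f : ℝ → [0,∞) be an integrable log-concave function with 0 < ∫_{−∞}^∞ f(x) dx < ∞, ∫_{−∞}^∞ |x| f(x) dx < ∞, and ∫_{−∞}^∞ x f(x) dx = 0. Then ∫_0^∞ f(x) dx ≥ e^{−1} ∫_{−∞}^∞ f(x) dx. -/
open MeasureTheory Real Set

/-- Multiplicative rearrangement inequality for log-concave functions: moving two points towards
each other while keeping their sum does not decrease the product of the values. -/
lemma mul_le_mul_of_logConcave {f : ℝ → ℝ} (hf_nonneg : ∀ x, 0 ≤ f x)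
    (hf : ∀ x y : ℝ, ∀ l : ℝ, 0 ≤ l → l ≤ 1 →
      f x ^ (1 - l) * f y ^ l ≤ f ((1 - l) * x + l * y))
    {p q x y : ℝ} (hpx : p ≤ x) (hxq : x ≤ q) (hxy : x + y = p + q) :
    f p * f q ≤ f x * f y := by
  rcases (hpx.trans hxq).eq_or_lt with rfl | hpq
  · obtain rfl : x = p := le_antisymm hxq hpx
    obtain rfl : y = x := by linarith
    rfl
  have hd : 0 < q - p := sub_pos.2 hpq
  obtain ⟨l, hl⟩ : ∃ l, l = (x - p) / (q - p) := ⟨_, rfl⟩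
  have hl0 : 0 ≤ l := by rw [hl]; exact div_nonneg (by linarith) hd.le
  have hl1 : l ≤ 1 := by rw [hl, div_le_one hd]; linarith
  have hlx : l * (q - p) = x - p := by rw [hl]; field_simp
  have h1 := hf p q l hl0 hl1
  have h2 := hf p q (1 - l) (by linarith) (by linarith)
  rw [show (1 - l) * p + l * q = x by linarith] at h1
  rw [show (1 - (1 - l)) * p + (1 - l) * q = y by linarith, sub_sub_cancel] at h2
  have hsplit : ∀ z : ℝ, 0 ≤ z → z = z ^ (1 - l) * z ^ l := fun z hz => by
    rw [← rpow_add_of_nonneg hz (by linarith) hl0, sub_add_cancel, rpow_one]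
  calc f p * f q = (f p ^ (1 - l) * f q ^ l) * (f p ^ l * f q ^ (1 - l)) := by
        conv_lhs => rw [hsplit _ (hf_nonneg p), hsplit _ (hf_nonneg q)]
        ring
    _ ≤ f x * f y := by
        have := hf_nonneg p
        have := hf_nonneg q
        have := hf_nonneg x
        gcongr

/-- Layer-cake formula for the positive part of the first moment. -/
lemma integrableOn_tail_and_integral_eq {f : ℝ → ℝ} (hf_nonneg : ∀ x, 0 ≤ f x)
    (hf : Integrable f) (hxf : IntegrableOn (fun x => x * f x) (Ioi 0)) :
    IntegrableOn (fun t => ∫ x in Ioi t, f x) (Ioi 0) ∧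
      ∫ t in Ioi (0 : ℝ), ∫ x in Ioi t, f x = ∫ x in Ioi (0 : ℝ), x * f x := by
  set Φ : ℝ × ℝ → ℝ := {p : ℝ × ℝ | 0 < p.1 ∧ p.1 < p.2}.indicator (fun p => f p.2) with hΦ
  have hS : MeasurableSet {p : ℝ × ℝ | 0 < p.1 ∧ p.1 < p.2} :=
    (measurableSet_lt measurable_const measurable_fst).inter
      (measurableSet_lt measurable_fst measurable_snd)
  have hx : ∀ x, (fun t => Φ (t, x)) = (Ioo 0 x).indicator (fun _ => f x) := fun x => by
    ext t; simp [hΦ, indicator]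
  have ht : ∀ t, (fun x => Φ (t, x)) =
      (Ioi t).indicator (fun x => (Ioi 0).indicator (fun _ => f x) t) := fun t => by
    ext x
    simp only [hΦ, indicator, mem_ofPred_eq, mem_Ioi]
    split_ifs <;> simp_all
  have hix : ∀ x, ∫ t, Φ (t, x) = (Ioi 0).indicator (fun x => x * f x) x := fun x => by
    rw [hx, integral_indicator measurableSet_Ioo]
    by_cases h : 0 < x
    · simp [h, h.le]
    · simp [h]
  have hit : ∀ t, ∫ x, Φ (t, x) = (Ioi 0).indicator (fun t => ∫ x in Ioi t, f x) t := fun t => by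
    rw [ht, integral_indicator measurableSet_Ioi]
    by_cases h : 0 < t <;> simp [h]
  have hΦ_nonneg : ∀ p, 0 ≤ Φ p := indicator_nonneg fun p _ => hf_nonneg p.2
  have hint : Integrable Φ (volume.prod volume) := by
    have hm : AEStronglyMeasurable Φ (volume.prod volume) :=
      (hf.aestronglyMeasurable.comp_snd).indicator hS
    refine (integrable_prod_iff' hm).2 ⟨.of_forall fun x => ?_, ?_⟩
    · rw [hx]
      exact (integrable_indicator_iff measurableSet_Ioo).2 (by simp)
    · simp_rw [norm_of_nonneg (hΦ_nonneg _), hix]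
      exact (integrable_indicator_iff measurableSet_Ioi).2 hxf
  constructor
  · rw [← integrable_indicator_iff measurableSet_Ioi]
    exact hint.integral_prod_left.congr (.of_forall hit)
  · rw [← integral_indicator measurableSet_Ioi, ← integral_indicator measurableSet_Ioi]
    simp_rw [← hix, ← hit]
    exact integral_integral_swap (f := fun t x => Φ (t, x)) hint

/-- Integral form of Grönwall's inequality, integrated once more. -/
lemma mul_integral_le_of_le_add_mul_integral {g : ℝ → ℝ} (hg : Continuous g) {a c : ℝ} (hc : 0 ≤ c)
    (h : ∀ s, 0 ≤ s → g s ≤ a + c * ∫ u in (0 : ℝ)..s, g u) {L : ℝ} (hL : 0 ≤ L) :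
    c * ∫ u in (0 : ℝ)..L, g u ≤ a * (exp (c * L) - 1) := by
  set K : ℝ → ℝ := fun s => exp (-(c * s)) * (a + c * ∫ u in (0 : ℝ)..s, g u) with hK
  have hd : ∀ s, HasDerivAt K
      (exp (-(c * s)) * -(c * 1) * (a + c * ∫ u in (0 : ℝ)..s, g u) +
        exp (-(c * s)) * (c * g s)) s := fun s =>
    ((((hasDerivAt_id s).const_mul c).neg).exp).mul
      (((hg.integral_hasStrictDerivAt 0 s).hasDerivAt.const_mul c).const_add a)
  have hanti : AntitoneOn K (Ici 0) := by
    refine antitoneOn_of_deriv_nonpos (convex_Ici 0)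
      (fun s _ => (hd s).continuousAt.continuousWithinAt)
      (fun s _ => (hd s).differentiableAt.differentiableWithinAt) fun s hs => ?_
    rw [interior_Ici] at hs
    rw [(hd s).deriv]
    have := mul_le_mul_of_nonneg_left (h s (le_of_lt hs)) (mul_nonneg (exp_pos (-(c * s))).le hc)
    linarith
  have hKL := hanti (mem_Ici.2 le_rfl) hL hL
  simp only [hK, mul_zero, exp_zero, intervalIntegral.integral_same, add_zero, exp_neg] at hKL
  rw [inv_mul_le_iff₀ (exp_pos _)] at hKL
  linarith

/-- A nonzero density with vanishing first moment charges both half-lines. -/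
lemma not_ae_mul_nonneg_of_integral_eq_zero {f : ℝ → ℝ} (hxf : Integrable (fun x => x * f x))
    (hmass : 0 < ∫ x, f x) (hcom : ∫ x, x * f x = 0) : ¬ ∀ᵐ x, 0 ≤ x * f x := fun h => by
  have h0 := (integral_eq_zero_iff_of_nonneg_ae h hxf).1 hcom
  refine hmass.ne' (integral_eq_zero_of_ae ?_)
  filter_upwards [h0, Measure.ae_ne volume (0 : ℝ)] with x hx hne
  exact (mul_eq_zero.1 hx).resolve_left hne

lemma not_ae_mul_nonpos_of_integral_eq_zero {f : ℝ → ℝ} (hxf : Integrable (fun x => x * f x))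
    (hmass : 0 < ∫ x, f x) (hcom : ∫ x, x * f x = 0) : ¬ ∀ᵐ x, x * f x ≤ 0 := fun h => by
  have h0 := (integral_eq_zero_iff_of_nonneg_ae (f := fun x => -(x * f x))
    (h.mono fun x hx => neg_nonneg.2 hx) hxf.neg).1 (by rw [integral_neg, hcom, neg_zero])
  refine hmass.ne' (integral_eq_zero_of_ae ?_)
  filter_upwards [h0, Measure.ae_ne volume (0 : ℝ)] with x hx hne
  exact (mul_eq_zero.1 (neg_eq_zero.1 hx)).resolve_left hne

lemma setIntegral_Ioi_pos_of_integral_mul_eq_zero {f : ℝ → ℝ} (hf_nonneg : ∀ x, 0 ≤ f x)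
    (hf : Integrable f) (hxf : Integrable (fun x => x * f x))
    (hmass : 0 < ∫ x, f x) (hcom : ∫ x, x * f x = 0) : 0 < ∫ x in Ioi (0 : ℝ), f x := by
  refine (integral_nonneg hf_nonneg).lt_of_ne' fun h => ?_
  have h0 := (integral_eq_zero_iff_of_nonneg hf_nonneg hf.integrableOn).1 h
  refine not_ae_mul_nonpos_of_integral_eq_zero hxf hmass hcom ?_
  filter_upwards [(ae_restrict_iff' measurableSet_Ioi).1 h0] with x hx
  rcases le_or_gt x 0 with hx0 | hx0
  · exact mul_nonpos_of_nonpos_of_nonneg hx0 (hf_nonneg x)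
  · simp [show f x = 0 from hx hx0]

lemma apply_zero_pos_of_logConcave {f : ℝ → ℝ} (hf_nonneg : ∀ x, 0 ≤ f x)
    (hf : ∀ x y : ℝ, ∀ l : ℝ, 0 ≤ l → l ≤ 1 →
      f x ^ (1 - l) * f y ^ l ≤ f ((1 - l) * x + l * y))
    (hxf : Integrable (fun x => x * f x))
    (hmass : 0 < ∫ x, f x) (hcom : ∫ x, x * f x = 0) : 0 < f 0 := by
  have hneg := not_ae_mul_nonneg_of_integral_eq_zero hxf hmass hcom
  have hpos := not_ae_mul_nonpos_of_integral_eq_zero hxf hmass hcom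
  obtain ⟨p, hp⟩ : ∃ p, p * f p < 0 := by
    by_contra! h
    exact hneg (.of_forall h)
  obtain ⟨q, hq⟩ : ∃ q, 0 < q * f q := by
    by_contra! h
    exact hpos (.of_forall h)
  have hp0 : p < 0 := by nlinarith [hf_nonneg p]
  have hq0 : 0 < q := by nlinarith [hf_nonneg q]
  have hfp : 0 < f p := by nlinarith [hf_nonneg p]
  have hfq : 0 < f q := by nlinarith [hf_nonneg q]
  by_contra! h0
  have h0 : f 0 = 0 := le_antisymm h0 (hf_nonneg 0)
  have := mul_le_mul_of_logConcave hf_nonneg hf hp0.le hq0.le (zero_add (p + q))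
  rw [h0, zero_mul] at this
  exact (mul_pos hfp hfq).not_ge this

/-- One-dimensional functional Grünbaum inequality (Lovász–Vempala):
if `f : ℝ → [0,∞)` is integrable, log-concave, with positive total mass,
finite first moment, and `∫ x f(x) dx = 0`, then
`∫_0^∞ f ≥ e⁻¹ ∫_{-∞}^∞ f`. -/
theorem grunbaum_one_dim (f : ℝ → ℝ)
    (hf_nonneg : ∀ x, 0 ≤ f x)
    (hf_logconcave : ∀ x y : ℝ, ∀ l : ℝ, 0 ≤ l → l ≤ 1 →
      f x ^ (1 - l) * f y ^ l ≤ f ((1 - l) * x + l * y))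
    (hf_int : Integrable f)
    (hf_pos_mass : 0 < ∫ x : ℝ, f x)
    (hf_moment : Integrable (fun x => |x| * f x))
    (hf_com : (∫ x : ℝ, x * f x) = 0) :
    Real.exp (-1) * ∫ x : ℝ, f x ≤ ∫ x in Set.Ioi (0 : ℝ), f x := by
  have hxf : Integrable (fun x => x * f x) :=
    hf_moment.mono (aestronglyMeasurable_id.mul hf_int.aestronglyMeasurable)
      (.of_forall fun x => by simp)
  have ha := setIntegral_Ioi_pos_of_integral_mul_eq_zero hf_nonneg hf_int hxf hf_pos_mass hf_com
  have hf0 := apply_zero_pos_of_logConcave hf_nonneg hf_logconcave hxf hf_pos_mass hf_com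
  have hneg_int : Integrable (fun x => f (-x)) := hf_int.comp_neg
  have hxneg : Integrable (fun x => x * f (-x)) := by
    simpa using hxf.comp_neg.neg
  set M := ∫ x, f x
  set a := ∫ x in Ioi (0 : ℝ), f x with ha_def
  obtain ⟨-, htail⟩ := integrableOn_tail_and_integral_eq hf_nonneg hf_int hxf.integrableOn
  obtain ⟨htail_int', htail'⟩ := integrableOn_tail_and_integral_eq (fun x => hf_nonneg (-x))
    hneg_int hxneg.integrableOn
  have hmom : ∫ x in Ioi (0 : ℝ), x * f x = ∫ x in Ioi (0 : ℝ), x * f (-x) := by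
    have h1 := intervalIntegral.integral_Iic_add_Ioi (b := (0 : ℝ)) hxf.integrableOn
      hxf.integrableOn
    have h2 := integral_comp_neg_Ioi (0 : ℝ) (fun x => x * f x)
    simp only [neg_mul, integral_neg, neg_zero] at h2
    linarith
  have hshift : ∀ x, ∫ t in Ioi (0 : ℝ), f (x + t) = ∫ t in Ioi x, f t := fun x => by
    have h := (measurePreserving_add_left volume x).setIntegral_preimage_emb
      (measurableEmbedding_addLeft x) f (Ioi x)
    rwa [preimage_const_add_Ioi, sub_self] at h
  -- the hazard rate `f / ∫_x^∞ f` is at least its value at `0` on the right half-line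
  have hright : f 0 * ∫ t in Ioi (0 : ℝ), ∫ x in Ioi t, f x ≤ a * a := by
    rw [← integral_const_mul, ha_def, ← integral_const_mul]
    refine integral_mono_of_nonneg (.of_forall fun t => mul_nonneg hf0.le
      (integral_nonneg hf_nonneg)) (hf_int.integrableOn.const_mul a) ?_
    refine (ae_restrict_iff' measurableSet_Ioi).2 (.of_forall fun x hx => ?_)
    have hx : 0 < x := hx
    show f 0 * _ ≤ a * f x
    rw [← hshift, ← integral_const_mul, mul_comm a, ha_def, ← integral_const_mul]
    refine setIntegral_mono_on ((hf_int.comp_add_left x).integrableOn.const_mul _)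
      (hf_int.integrableOn.const_mul _) measurableSet_Ioi fun t ht => ?_
    have ht : 0 < t := ht
    exact mul_le_mul_of_logConcave hf_nonneg hf_logconcave hx.le (by linarith) (by ring)
  -- and at most that value on the left half-line
  have hleft : ∀ s, 0 ≤ s → f (-s) * a ≤ f 0 * ∫ t in Ioi (-s), f t := fun s hs => by
    rw [← hshift, ← integral_const_mul, ← integral_const_mul]
    refine setIntegral_mono_on (hf_int.integrableOn.const_mul _)
      ((hf_int.comp_add_left (-s)).integrableOn.const_mul _) measurableSet_Ioi fun t ht => ?_
    have ht : 0 < t := ht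
    exact mul_le_mul_of_logConcave hf_nonneg hf_logconcave (by linarith) ht.le (by ring)
  set g : ℝ → ℝ := fun s => a + ∫ u in (0 : ℝ)..s, f (-u) with hg
  have hg_cont : Continuous g :=
    continuous_const.add (intervalIntegral.continuous_primitive
      (fun _ _ => hneg_int.intervalIntegrable) 0)
  have hg_tail : ∀ s, ∫ t in Ioi (-s), f t = g s := fun s => by
    have h := intervalIntegral.integral_interval_add_Ioi (a := -s) (b := 0)
      hf_int.integrableOn hf_int.integrableOn
    have h' := intervalIntegral.integral_comp_neg (a := 0) (b := s) f
    rw [neg_zero] at h'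
    simp only [hg]
    linarith
  have hg_compl : ∀ s, ∫ x in Ioi s, f (-x) = M - g s := fun s => by
    have h := intervalIntegral.integral_Iic_add_Ioi (b := -s) hf_int.integrableOn
      hf_int.integrableOn
    rw [integral_comp_neg_Ioi, ← hg_tail]
    linarith
  have hgronwall : ∀ s, 0 ≤ s → g s ≤ a + f 0 / a * ∫ u in (0 : ℝ)..s, g u := fun s hs => by
    rw [← intervalIntegral.integral_const_mul]
    refine add_le_add_right (intervalIntegral.integral_mono_on hs hneg_int.intervalIntegrable
      (hg_cont.intervalIntegrable _ _ |>.const_mul _) fun u hu => ?_) a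
    rw [div_mul_eq_mul_div, le_div_iff₀ ha, ← hg_tail]
    exact hleft u hu.1
  have haM : a ≤ M := setIntegral_le_integral hf_int (.of_forall hf_nonneg)
  set L := a / f 0 * log (M / a) with hL_def
  have hL : 0 ≤ L := mul_nonneg (div_pos ha hf0).le (log_nonneg ((one_le_div ha).2 haM))
  have hcL : f 0 / a * L = log (M / a) := by
    rw [hL_def]; field_simp
  have hupper := mul_integral_le_of_le_add_mul_integral hg_cont (div_pos hf0 ha).le
    hgronwall hL
  rw [hcL, exp_log (div_pos hf_pos_mass ha)] at hupper
  have htrunc : M * L - ∫ u in (0 : ℝ)..L, g u ≤ ∫ t in Ioi (0 : ℝ), ∫ x in Ioi t, f x := by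
    rw [htail, hmom, ← htail']
    calc M * L - ∫ u in (0 : ℝ)..L, g u = ∫ u in (0 : ℝ)..L, (M - g u) := by
          rw [intervalIntegral.integral_sub (by simp) (hg_cont.intervalIntegrable _ _)]
          simp [mul_comm]
      _ = ∫ t in Ioc (0 : ℝ) L, ∫ x in Ioi t, f (-x) := by
          simp_rw [hg_compl, intervalIntegral.integral_of_le hL]
      _ ≤ _ := setIntegral_mono_set htail_int'
          (.of_forall fun t => integral_nonneg fun x => hf_nonneg (-x))
          Ioc_subset_Ioi_self.eventuallyLE
  have hlog : log (M / a) ≤ 1 := by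
    have h1 := mul_le_mul_of_nonneg_left htrunc (div_pos hf0 ha).le
    have h2 : f 0 / a * ∫ t in Ioi (0 : ℝ), ∫ x in Ioi t, f x ≤ a := by
      rw [div_mul_eq_mul_div, div_le_iff₀ ha]
      exact hright
    have h3 : a * (M / a - 1) = M - a := by field_simp
    have h4 : f 0 / a * (M * L) = M * log (M / a) := by rw [← hcL]; ring
    nlinarith
  rw [log_le_iff_le_exp (div_pos hf_pos_mass ha), div_le_iff₀ ha] at hlog
  calc exp (-1) * M ≤ exp (-1) * (exp 1 * a) := by gcongr
    _ = a := by rw [← mul_assoc, ← exp_add]; simp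
end

section
/- Let β > 0, h > 0, and let f : ℝ → [0,∞) be a measurable function with 0 < ∫_{−∞}^∞ f(x) dx < ∞ and ∫_{−∞}^∞ |x| f(x) dx < ∞, such that ∫_a^∞ f(x) dx ≤ (h/β) e^{−βa} for every a ∈ ℝ. Let Ψ ∈ ℝ be defined by (h/β) e^{−βΨ} = ∫_{−∞}^∞ f(x) dx, and set F(x) = 𝟙_{[Ψ,∞)}(x) h e^{−βx}. Then ∫_{−∞}^∞ F(x) dx = ∫_{−∞}^∞ f(x) dx and ∫_{−∞}^∞ x F(x) dx ≥ ∫_{−∞}^∞ x f(x) dx; that is, replacing f by the truncated exponential F of height h moves the center of mass to the right. -/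
open MeasureTheory Real Set

/-- Layer-cake formula for the positive part of the first moment about `c`. -/
theorem lintegral_ofReal_mul_sub_eq {f : ℝ → ℝ} (hf_nonneg : ∀ x, 0 ≤ f x)
    (hf_meas : Measurable f) (hf_int : Integrable f) (c : ℝ) :
    ∫⁻ x, ENNReal.ofReal (f x * (x - c)) =
      ∫⁻ t in Ioi (0 : ℝ), ENNReal.ofReal (∫ x in Ioi (c + t), f x) := by
  have hd : Measurable fun x => ENNReal.ofReal (f x) := hf_meas.ennreal_ofReal
  have hm : Measurable fun x : ℝ => max (x - c) 0 := by fun_prop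
  have key := lintegral_eq_lintegral_meas_lt
    (volume.withDensity fun x => ENNReal.ofReal (f x))
    (Filter.Eventually.of_forall fun x => le_max_right (x - c) 0) hm.aemeasurable
  rw [lintegral_withDensity_eq_lintegral_mul _ hd hm.ennreal_ofReal] at key
  calc
    _ = ∫⁻ x, ENNReal.ofReal (f x) * ENNReal.ofReal (max (x - c) 0) := by
      refine lintegral_congr fun x => ?_
      rw [ENNReal.ofReal_mul (hf_nonneg x), ENNReal.ofReal_max]
      simp
    _ = _ := key
    _ = _ := by
      refine setLIntegral_congr_fun measurableSet_Ioi fun t ht => ?_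
      have hs : {x : ℝ | t < max (x - c) 0} = Ioi (c + t) := by
        ext x
        have ht' : ¬ t < 0 := not_lt.2 (le_of_lt ht)
        simp [ht', lt_sub_iff_add_lt']
      simp only [hs]
      rw [withDensity_apply _ measurableSet_Ioi, ofReal_integral_eq_lintegral_ofReal
        hf_int.integrableOn (Filter.Eventually.of_forall hf_nonneg)]

/-- If `f` and `g` have the same mass, `g` vanishes to the left of `c`, and `g` has the heavier
right tails beyond `c`, then the first moment of `f` is at most that of `g`. -/
theorem integral_mul_le_integral_mul_of_tail_le {f g : ℝ → ℝ} {c : ℝ}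
    (hf_nonneg : ∀ x, 0 ≤ f x) (hf_meas : Measurable f) (hf_int : Integrable f)
    (hf_moment : Integrable fun x => x * f x)
    (hg_nonneg : ∀ x, 0 ≤ g x) (hg_meas : Measurable g) (hg_int : Integrable g)
    (hg_moment : Integrable fun x => x * g x) (hg_left : ∀ x < c, g x = 0)
    (hmass : ∫ x, f x = ∫ x, g x)
    (htail : ∀ a, c ≤ a → ∫ x in Ioi a, f x ≤ ∫ x in Ioi a, g x) :
    ∫ x, x * f x ≤ ∫ x, x * g x := by
  have split {u : ℝ → ℝ} (hu : Integrable u) (hu' : Integrable fun x => x * u x) :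
      Integrable (fun x => u x * (x - c)) ∧
        ∫ x, u x * (x - c) = (∫ x, x * u x) - c * ∫ x, u x := by
    have e : (fun x => u x * (x - c)) = fun x => x * u x - c * u x := by
      ext x; ring
    rw [e, integral_sub hu' (hu.const_mul c), integral_const_mul]
    exact ⟨hu'.sub (hu.const_mul c), rfl⟩
  obtain ⟨hfi, hfe⟩ := split hf_int hf_moment
  obtain ⟨hgi, hge⟩ := split hg_int hg_moment
  have hg_pos : ∀ x, 0 ≤ g x * (x - c) := fun x => by
    rcases lt_or_ge x c with hx | hx
    · simp [hg_left x hx]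
    · exact mul_nonneg (hg_nonneg x) (sub_nonneg.2 hx)
  have hle : ∫⁻ x, ENNReal.ofReal (f x * (x - c)) ≤ ∫⁻ x, ENNReal.ofReal (g x * (x - c)) := by
    rw [lintegral_ofReal_mul_sub_eq hf_nonneg hf_meas hf_int,
      lintegral_ofReal_mul_sub_eq hg_nonneg hg_meas hg_int]
    refine setLIntegral_mono' measurableSet_Ioi fun t ht => ENNReal.ofReal_le_ofReal ?_
    exact htail _ (le_add_of_nonneg_right (le_of_lt ht))
  have hcentred : ∫ x, f x * (x - c) ≤ ∫ x, g x * (x - c) := by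
    rw [integral_eq_lintegral_pos_part_sub_lintegral_neg_part hfi,
      integral_eq_lintegral_of_nonneg_ae (Filter.Eventually.of_forall hg_pos)
        hgi.aestronglyMeasurable]
    exact (sub_le_self _ ENNReal.toReal_nonneg).trans
      (ENNReal.toReal_mono hgi.lintegral_lt_top.ne hle)
  rw [hfe, hge, hmass] at hcentred
  linarith

theorem integrableOn_mul_exp_neg_mul_Ici {β : ℝ} (hβ : 0 < β) (c : ℝ) :
    IntegrableOn (fun x => x * exp (-β * x)) (Ici c) := by
  rw [integrableOn_Ici_iff_integrableOn_Ioi]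
  refine integrable_of_isBigO_exp_neg (half_pos hβ) (by fun_prop) ?_
  have h1 := (isLittleO_pow_exp_pos_mul_atTop 1 (half_pos hβ)).isBigO.mul
    (Asymptotics.isBigO_refl (fun x : ℝ => exp (-β * x)) Filter.atTop)
  refine h1.congr (fun x => by simp) fun x => ?_
  rw [← exp_add]
  ring_nf

/-- Key property of the critical height: if `h` is at least the critical
height of `f` for exponent `β` (i.e. `∫_a^∞ f ≤ (h/β) e^{-βa}` for all `a`)
and `F = 𝟙_{[Ψ,∞)} h e^{-βx}` has the same total mass as `f`, then the
center of mass of `F` is to the right of that of `f`. -/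
theorem truncated_exponential_moves_com_right (β h : ℝ) (hβ : 0 < β) (hh : 0 < h)
    (f : ℝ → ℝ) (hf_nonneg : ∀ x, 0 ≤ f x) (hf_meas : Measurable f)
    (hf_int : Integrable f) (hf_pos_mass : 0 < ∫ x : ℝ, f x)
    (hf_moment : Integrable (fun x => |x| * f x))
    (h_tail : ∀ a : ℝ, (∫ x in Set.Ioi a, f x) ≤ (h / β) * Real.exp (-β * a))
    (Ψ : ℝ) (hΨ : (h / β) * Real.exp (-β * Ψ) = ∫ x : ℝ, f x)
    (F : ℝ → ℝ)
    (hF : F = Set.indicator (Set.Ici Ψ) (fun x => h * Real.exp (-β * x))) :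
    (∫ x : ℝ, F x) = (∫ x : ℝ, f x) ∧
    (∫ x : ℝ, x * f x) ≤ ∫ x : ℝ, x * F x := by
  have hβ' : -β < 0 := neg_lt_zero.2 hβ
  have hexp (a : ℝ) : ∫ x in Ioi a, h * exp (-β * x) = h / β * exp (-β * a) := by
    rw [integral_const_mul, integral_exp_mul_Ioi hβ']
    field_simp
  have hmass : ∫ x, F x = ∫ x, f x := by
    rw [hF, integral_indicator measurableSet_Ici, integral_Ici_eq_integral_Ioi, hexp, hΨ]
  have hF_nonneg : ∀ x, 0 ≤ F x := fun x => by
    rw [hF]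
    exact indicator_nonneg (fun y _ => by positivity) x
  have hF_meas : Measurable F := by
    rw [hF]
    exact Measurable.indicator (by fun_prop) measurableSet_Ici
  have hF_int : Integrable F := by
    rw [hF, integrable_indicator_iff measurableSet_Ici, integrableOn_Ici_iff_integrableOn_Ioi]
    exact (integrableOn_exp_mul_Ioi hβ' Ψ).const_mul h
  have hF_moment : Integrable fun x => x * F x := by
    have e : (fun x => x * F x) = (Ici Ψ).indicator fun x => h * (x * exp (-β * x)) := by
      ext x
      by_cases hx : x ∈ Ici Ψ <;> simp only [hF, hx, indicator_of_mem, indicator_of_notMem,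
        not_false_eq_true, mul_zero]
      ring
    rw [e, integrable_indicator_iff measurableSet_Ici]
    exact (integrableOn_mul_exp_neg_mul_Ici hβ Ψ).const_mul h
  have hf_moment' : Integrable fun x => x * f x :=
    hf_moment.mono (by fun_prop) (Filter.Eventually.of_forall fun x => by simp)
  refine ⟨hmass, integral_mul_le_integral_mul_of_tail_le hf_nonneg hf_meas hf_int hf_moment'
    hF_nonneg hF_meas hF_int hF_moment (c := Ψ) (fun x hx => ?_) hmass.symm fun a ha => ?_⟩
  · rw [hF]
    exact indicator_of_notMem (not_le.2 hx) _
  · refine (h_tail a).trans_eq ?_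
    rw [← hexp]
    refine setIntegral_congr_fun measurableSet_Ioi fun x hx => ?_
    have hx' : x ∈ Ici Ψ := ha.trans (le_of_lt hx)
    simp only [hF, indicator_of_mem hx']
end

section
/- Let f : ℝ → (0,∞) be continuous and strictly log-concave (i.e., log f is strictly concave), with f(x) e^{γ|x|} → 0 as |x| → ∞ for every γ > 0, and let β = f(0) / ∫_0^∞ f(x) dx, so that ∫_0^∞ f(x) dx = ∫_0^∞ f(0) e^{−βx} dx. Then ∫_a^∞ f(x) dx ≤ (f(0)/β) e^{−βa} for every a ∈ ℝ; that is, the critical height of f for the exponent β equals f(0), namely max_{a ∈ ℝ} β e^{βa} ∫_a^∞ f(x) dx = f(0), with the maximum attained at a = 0. -/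
open MeasureTheory Real Set Filter

/-- A concave function on `ℝ` has a larger sum at two inner points than at the end points
with the same sum. -/
lemma ConcaveOn.add_le_add_of_mem_Icc {L : ℝ → ℝ} (hL : ConcaveOn ℝ Set.univ L) {x u y : ℝ}
    (hxu : x ≤ u) (huy : u ≤ y) : L x + L y ≤ L u + L (x + y - u) := by
  rcases (hxu.trans huy).eq_or_lt with h | h
  · obtain rfl : x = u := by linarith
    rw [add_sub_cancel_left]
  · have hd : 0 < y - x := sub_pos.2 h
    set t := (u - x) / (y - x) with ht
    have htd : t * (y - x) = u - x := div_mul_cancel₀ _ hd.ne'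
    have ht0 : 0 ≤ t := div_nonneg (by linarith) hd.le
    have ht1 : 0 ≤ 1 - t := by
      rw [sub_nonneg, ht, div_le_one hd]
      linarith
    have h1 := hL.2 (mem_univ x) (mem_univ y) ht1 ht0 (by ring)
    have h2 := hL.2 (mem_univ x) (mem_univ y) ht0 ht1 (by ring)
    simp only [smul_eq_mul] at h1 h2
    rw [show (1 - t) * x + t * y = u by linarith] at h1
    rw [show t * x + (1 - t) * y = x + y - u by linarith] at h2
    linarith

/-- Multiplicative form of `ConcaveOn.add_le_add_of_mem_Icc` for log-concave functions. -/
lemma mul_le_mul_of_concaveOn_log {f : ℝ → ℝ} (hf_pos : ∀ x, 0 < f x)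
    (hf : ConcaveOn ℝ Set.univ (fun x => Real.log (f x))) {x u y : ℝ}
    (hxu : x ≤ u) (huy : u ≤ y) : f x * f y ≤ f u * f (x + y - u) := by
  have h := hf.add_le_add_of_mem_Icc hxu huy
  rw [← Real.log_mul (hf_pos _).ne' (hf_pos _).ne',
    ← Real.log_mul (hf_pos _).ne' (hf_pos _).ne'] at h
  exact (Real.log_le_log_iff (mul_pos (hf_pos _) (hf_pos _))
    (mul_pos (hf_pos _) (hf_pos _))).1 h

lemma setIntegral_Ioi_comp_add_left (f : ℝ → ℝ) (a : ℝ) :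
    ∫ t in Set.Ioi (0 : ℝ), f (a + t) = ∫ x in Set.Ioi a, f x := by
  have h := (measurePreserving_add_left (volume : Measure ℝ) a).setIntegral_preimage_emb
    (measurableEmbedding_addLeft a) f (Set.Ioi a)
  simpa using h

lemma integrableOn_Ioi_comp_add_left {f : ℝ → ℝ} {a : ℝ} (hf : IntegrableOn f (Set.Ioi a)) :
    IntegrableOn (fun t => f (a + t)) (Set.Ioi 0) := by
  have h := ((measurePreserving_add_left (volume : Measure ℝ) a).integrableOn_comp_preimage
    (measurableEmbedding_addLeft a)).2 hf
  simpa [Function.comp_def] using h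

/-- The tail integral of a continuous function has derivative minus that function. -/
lemma hasDerivAt_setIntegral_Ioi {f : ℝ → ℝ} (hf_cont : Continuous f)
    (hf : ∀ a, IntegrableOn f (Set.Ioi a)) (a : ℝ) :
    HasDerivAt (fun b => ∫ x in Set.Ioi b, f x) (-f a) a := by
  have h : (fun b => ∫ x in Set.Ioi b, f x) =
      fun b => (∫ x in Set.Ioi (0 : ℝ), f x) - ∫ x in (0 : ℝ)..b, f x := by
    funext b
    rw [← intervalIntegral.integral_interval_add_Ioi (hf 0) (hf b)]
    ring
  rw [h]
  exact (hf_cont.integral_hasStrictDerivAt 0 a).hasDerivAt.const_sub _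

/-- A tail integral weighted by an exponential is maximal at `0` as soon as the hazard rate
`f a / ∫_a^∞ f` lies above `β` for `a ≥ 0` and below `β` for `a ≤ 0`. -/
lemma exp_mul_setIntegral_Ioi_le {f : ℝ → ℝ} (hf_cont : Continuous f)
    (hf : ∀ a, IntegrableOn f (Set.Ioi a)) {β : ℝ}
    (h_nonneg : ∀ a, 0 ≤ a → β * ∫ x in Set.Ioi a, f x ≤ f a)
    (h_nonpos : ∀ a, a ≤ 0 → f a ≤ β * ∫ x in Set.Ioi a, f x) (a : ℝ) :
    Real.exp (β * a) * ∫ x in Set.Ioi a, f x ≤ ∫ x in Set.Ioi (0 : ℝ), f x := by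
  set G : ℝ → ℝ := fun a => Real.exp (β * a) * ∫ x in Set.Ioi a, f x with hG
  have hderiv (b : ℝ) :
      HasDerivAt G (Real.exp (β * b) * (β * (∫ x in Set.Ioi b, f x) - f b)) b := by
    have h1 : HasDerivAt (fun b => Real.exp (β * b)) (Real.exp (β * b) * (β * 1)) b :=
      ((hasDerivAt_id b).const_mul β).exp
    exact (h1.mul (hasDerivAt_setIntegral_Ioi hf_cont hf b)).congr_deriv (by ring)
  have hcont : Continuous G := continuous_iff_continuousAt.2 fun b => (hderiv b).continuousAt
  have hG0 : G 0 = ∫ x in Set.Ioi (0 : ℝ), f x := by simp [hG]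
  rw [← hG0]
  rcases le_total 0 a with ha | ha
  · refine antitoneOn_of_hasDerivWithinAt_nonpos (convex_Ici 0) hcont.continuousOn
      (fun b _ => (hderiv b).hasDerivWithinAt) (fun b hb => ?_) self_mem_Ici ha ha
    rw [interior_Ici] at hb
    exact mul_nonpos_of_nonneg_of_nonpos (Real.exp_pos _).le
      (sub_nonpos.2 (h_nonneg b (le_of_lt hb)))
  · refine monotoneOn_of_hasDerivWithinAt_nonneg (convex_Iic 0) hcont.continuousOn
      (fun b _ => (hderiv b).hasDerivWithinAt) (fun b hb => ?_) ha self_mem_Iic ha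
    rw [interior_Iic] at hb
    exact mul_nonneg (Real.exp_pos _).le (sub_nonneg.2 (h_nonpos b (le_of_lt hb)))

/-- For a positive continuous strictly log-concave function `f` with
super-exponential decay at `±∞`, and `β = f(0) / ∫_0^∞ f`, the critical
height of `f` for the exponent `β` equals `f(0)`:
`∫_a^∞ f ≤ (f(0)/β) e^{-βa}` for all `a`, and
`max_a β e^{βa} ∫_a^∞ f = f(0)`, attained at `a = 0`. -/
theorem critical_height_eq_value_at_zero (f : ℝ → ℝ)
    (hf_pos : ∀ x, 0 < f x) (hf_cont : Continuous f)
    (hf_strict : StrictConcaveOn ℝ Set.univ (fun x => Real.log (f x)))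
    (hf_decay_top : ∀ γ : ℝ, 0 < γ →
      Tendsto (fun x => f x * Real.exp (γ * |x|)) atTop (nhds 0))
    (hf_decay_bot : ∀ γ : ℝ, 0 < γ →
      Tendsto (fun x => f x * Real.exp (γ * |x|)) atBot (nhds 0))
    (β : ℝ) (hβ : β = f 0 / ∫ x in Set.Ioi (0 : ℝ), f x) :
    (∀ a : ℝ, (∫ x in Set.Ioi a, f x) ≤ (f 0 / β) * Real.exp (-β * a)) ∧
    IsGreatest
      (Set.range (fun a => β * Real.exp (β * a) * ∫ x in Set.Ioi a, f x))
      (f 0) ∧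
    β * Real.exp (β * 0) * (∫ x in Set.Ioi (0 : ℝ), f x) = f 0 := by
  have hf_int (a : ℝ) : IntegrableOn f (Set.Ioi a) := by
    refine integrable_of_isBigO_exp_neg one_pos hf_cont.continuousOn ?_
    refine (Asymptotics.isLittleO_of_tendsto (fun x hx => absurd hx (Real.exp_pos _).ne')
      ((hf_decay_top 1 one_pos).congr' ?_)).isBigO
    filter_upwards [eventually_ge_atTop 0] with x hx
    rw [abs_of_nonneg hx, neg_mul, Real.exp_neg, div_inv_eq_mul]
  have hF0 : 0 < ∫ x in Set.Ioi (0 : ℝ), f x := by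
    rw [setIntegral_pos_iff_support_of_nonneg_ae
      (Eventually.of_forall fun x => (hf_pos x).le) (hf_int 0)]
    have hsupp : Function.support f = Set.univ :=
      Set.eq_univ_of_forall fun x => (hf_pos x).ne'
    simp [hsupp]
  have hβ_pos : 0 < β := hβ ▸ div_pos (hf_pos 0) hF0
  have hβF : β * ∫ x in Set.Ioi (0 : ℝ), f x = f 0 := by rw [hβ, div_mul_cancel₀ _ hF0.ne']
  have hconc := hf_strict.concaveOn
  have h_nonneg (a : ℝ) (ha : 0 ≤ a) : β * ∫ x in Set.Ioi a, f x ≤ f a := by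
    have h : ∫ t in Set.Ioi (0 : ℝ), f 0 * f (a + t) ≤ ∫ t in Set.Ioi (0 : ℝ), f a * f t := by
      refine setIntegral_mono_on ((integrableOn_Ioi_comp_add_left (hf_int a)).const_mul _)
        ((hf_int 0).const_mul _) measurableSet_Ioi fun t ht => ?_
      have h := mul_le_mul_of_concaveOn_log hf_pos hconc ha
        (show a ≤ a + t from le_add_of_nonneg_right (le_of_lt ht))
      rwa [show 0 + (a + t) - a = t by ring] at h
    rw [integral_const_mul, integral_const_mul, setIntegral_Ioi_comp_add_left] at h
    rwa [hβ, div_mul_eq_mul_div, div_le_iff₀ hF0]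
  have h_nonpos (a : ℝ) (ha : a ≤ 0) : f a ≤ β * ∫ x in Set.Ioi a, f x := by
    have h : ∫ t in Set.Ioi (0 : ℝ), f a * f t ≤ ∫ t in Set.Ioi (0 : ℝ), f 0 * f (a + t) := by
      refine setIntegral_mono_on ((hf_int 0).const_mul _)
        ((integrableOn_Ioi_comp_add_left (hf_int a)).const_mul _) measurableSet_Ioi
        fun t ht => ?_
      have h := mul_le_mul_of_concaveOn_log hf_pos hconc ha (le_of_lt ht)
      rwa [sub_zero] at h
    rw [integral_const_mul, integral_const_mul, setIntegral_Ioi_comp_add_left] at h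
    rwa [hβ, div_mul_eq_mul_div, le_div_iff₀ hF0]
  have hmax := exp_mul_setIntegral_Ioi_le hf_cont hf_int h_nonneg h_nonpos
  have h0 : β * Real.exp (β * 0) * (∫ x in Set.Ioi (0 : ℝ), f x) = f 0 := by
    rw [mul_zero, Real.exp_zero, mul_one, hβF]
  refine ⟨fun a => ?_, ⟨⟨0, h0⟩, ?_⟩, h0⟩
  · rw [← hβF, mul_div_cancel_left₀ _ hβ_pos.ne', neg_mul, Real.exp_neg, ← div_eq_mul_inv,
      le_div_iff₀ (Real.exp_pos _), mul_comm]
    exact hmax a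
  · rintro _ ⟨a, rfl⟩
    simp only [← hβF, mul_assoc]
    exact mul_le_mul_of_nonneg_left (hmax a) hβ_pos.le
end

section
/- Let f : ℝ → (0,∞) be continuous and strictly log-concave (log f strictly concave), with f(x) e^{γ|x|} → 0 as |x| → ∞ for every γ > 0, and let β > 0 satisfy ∫_0^∞ f(x) dx = ∫_0^∞ f(0) e^{−βx} dx = f(0)/β. Then there exists x₀ > 0 such that f(x) ≤ f(0) e^{−βx} for all x ∈ (−∞, 0] ∪ [x₀, ∞) and f(x) ≥ f(0) e^{−βx} for all x ∈ [0, x₀]. -/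
open MeasureTheory Real Set Filter

/-- A strictly concave function on the line exceeds, strictly between two points, the minimum of its
values at these points. -/
theorem StrictConcaveOn.min_lt_of_lt_of_lt {g : ℝ → ℝ} (hg : StrictConcaveOn ℝ Set.univ g)
    {x y z : ℝ} (hxy : x < y) (hyz : y < z) : min (g x) (g z) < g y :=
  hg.lt_on_openSegment (mem_univ x) (mem_univ z) (hxy.trans hyz).ne
    (by rw [openSegment_eq_Ioo (hxy.trans hyz)]; exact ⟨hxy, hyz⟩)

/-- Two continuous functions on `(a, ∞)`, one dominating the other, agree there if their integrals
do. -/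
theorem eqOn_Ioi_of_le_of_integral_eq {f g : ℝ → ℝ} {a : ℝ} (hf : Continuous f)
    (hg : Continuous g) (hfi : IntegrableOn f (Ioi a)) (hgi : IntegrableOn g (Ioi a))
    (hle : ∀ x ∈ Ioi a, f x ≤ g x) (heq : ∫ x in Ioi a, f x = ∫ x in Ioi a, g x) :
    EqOn f g (Ioi a) := by
  have hle' : f ≤ᵐ[volume.restrict (Ioi a)] g :=
    (ae_restrict_mem measurableSet_Ioi).mono hle
  exact Measure.eqOn_open_of_ae_eq ((integral_eq_iff_of_ae_le hfi hgi hle').1 heq) isOpen_Ioi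
    hf.continuousOn hg.continuousOn

/-- Intersection pattern of a strictly log-concave function with its
comparison exponential: if `∫_0^∞ f = f(0)/β`, then there is `x₀ > 0` with
`f ≤ f(0) e^{-βx}` on `(-∞,0] ∪ [x₀,∞)` and `f ≥ f(0) e^{-βx}` on `[0,x₀]`. -/
theorem comparison_exponential_intersection (f : ℝ → ℝ)
    (hf_pos : ∀ x, 0 < f x) (hf_cont : Continuous f)
    (hf_strict : StrictConcaveOn ℝ Set.univ (fun x => Real.log (f x)))
    (hf_decay_top : ∀ γ : ℝ, 0 < γ →
      Tendsto (fun x => f x * Real.exp (γ * |x|)) atTop (nhds 0))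
    (hf_decay_bot : ∀ γ : ℝ, 0 < γ →
      Tendsto (fun x => f x * Real.exp (γ * |x|)) atBot (nhds 0))
    (β : ℝ) (hβ : 0 < β)
    (hβf : (∫ x in Set.Ioi (0 : ℝ), f x) = f 0 / β) :
    ∃ x₀ : ℝ, 0 < x₀ ∧
      (∀ x ≤ (0 : ℝ), f x ≤ f 0 * Real.exp (-β * x)) ∧
      (∀ x, x₀ ≤ x → f x ≤ f 0 * Real.exp (-β * x)) ∧
      (∀ x, 0 ≤ x → x ≤ x₀ → f 0 * Real.exp (-β * x) ≤ f x) := by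
  have hf0 := hf_pos 0
  set E : ℝ → ℝ := fun x => f 0 * Real.exp (-β * x) with hE
  have hE_pos : ∀ x, 0 < E x := fun x => mul_pos hf0 (Real.exp_pos _)
  set g : ℝ → ℝ := fun x => Real.log (f x) - Real.log (E x) with hg_def
  have hlogE : ∀ x, Real.log (E x) = Real.log (f 0) + -β * x := fun x => by
    rw [hE, Real.log_mul hf0.ne' (Real.exp_ne_zero _), Real.log_exp]
  have hg : StrictConcaveOn ℝ Set.univ g := by
    refine hf_strict.sub_convexOn ⟨convex_univ, fun x _ y _ a b _ _ hab => le_of_eq ?_⟩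
    simp only [hlogE, smul_eq_mul]
    linear_combination (-Real.log (f 0)) * hab
  have hE_cont : Continuous E := by fun_prop
  have hg_cont : Continuous g :=
    (hf_cont.log fun x => (hf_pos x).ne').sub (hE_cont.log fun x => (hE_pos x).ne')
  have hg0 : g 0 = 0 := by simp [hg_def, hE]
  have hg_nonneg : ∀ x, 0 ≤ g x ↔ E x ≤ f x := fun x => by
    rw [sub_nonneg, Real.log_le_log_iff (hE_pos x) (hf_pos x)]
  have hg_nonpos : ∀ x, g x ≤ 0 ↔ f x ≤ E x := fun x => by
    rw [sub_nonpos, Real.log_le_log_iff (hf_pos x) (hE_pos x)]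
  have hE_int : IntegrableOn E (Ioi 0) :=
    (integrableOn_exp_mul_Ioi (neg_lt_zero.2 hβ) 0).const_mul (f 0)
  have hE_integral : ∫ x in Ioi (0 : ℝ), E x = f 0 / β := by
    rw [hE, integral_const_mul, integral_exp_mul_Ioi (neg_lt_zero.2 hβ)]
    simp [div_eq_mul_inv]
  have hf_int : IntegrableOn f (Ioi 0) :=
    Integrable.of_integral_ne_zero (hβf.trans_ne (div_pos hf0 hβ).ne')
  obtain ⟨a, ha, hga⟩ : ∃ a, 0 < a ∧ 0 < g a := by
    by_contra! hle
    have heq := eqOn_Ioi_of_le_of_integral_eq hf_cont hE_cont hf_int hE_int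
      (fun x hx => (hg_nonpos x).1 (hle x hx)) (hβf.trans hE_integral.symm)
    have hz : ∀ x, 0 < x → g x = 0 := fun x hx => by simp [hg_def, heq hx]
    have := hg.min_lt_of_lt_of_lt one_pos one_lt_two
    rw [hg0, hz 1 one_pos, hz 2 two_pos, min_self] at this
    exact this.false
  obtain ⟨b, hab, hfb⟩ : ∃ b, a ≤ b ∧ f b * Real.exp (β * |b|) < f 0 :=
    ((eventually_ge_atTop a).and ((hf_decay_top β hβ).eventually_lt_const hf0)).exists
  have hgb : g b ≤ 0 := by
    rw [abs_of_pos (ha.trans_le hab)] at hfb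
    rw [hg_nonpos, hE]
    simp only [neg_mul, Real.exp_neg]
    rw [← div_eq_mul_inv, le_div_iff₀ (Real.exp_pos _)]
    exact hfb.le
  obtain ⟨x₀, hx₀, hgx₀⟩ := intermediate_value_Icc' hab hg_cont.continuousOn ⟨hgb, hga.le⟩
  have hx₀_pos : 0 < x₀ := ha.trans_le hx₀.1
  refine ⟨x₀, hx₀_pos, fun x hx => (hg_nonpos x).1 ?_, fun x hx => (hg_nonpos x).1 ?_,
    fun x hx hx' => (hg_nonneg x).1 ?_⟩
  · rcases hx.eq_or_lt with rfl | hx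
    · exact hg0.le
    · by_contra! h
      have := hg.min_lt_of_lt_of_lt hx hx₀_pos
      rw [hgx₀, hg0, min_eq_right h.le] at this
      exact this.false
  · rcases hx.eq_or_lt with rfl | hx
    · exact hgx₀.le
    · by_contra! h
      have := hg.min_lt_of_lt_of_lt hx₀_pos hx
      rw [hgx₀, hg0, min_eq_left h.le] at this
      exact this.false
  · rcases hx.eq_or_lt with rfl | hx
    · exact hg0.ge
    · rcases hx'.eq_or_lt with rfl | hx'
      · exact hgx₀.ge
      · have := hg.min_lt_of_lt_of_lt hx hx'
        rw [hgx₀, hg0, min_self] at this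
        exact this.le
end

section
/- Let β > 0, h > 0, Ψ ∈ ℝ, and F(x) = 𝟙_{[Ψ,∞)}(x) h e^{−βx} for x ∈ ℝ. If ∫_{−∞}^∞ x F(x) dx = 0, then Ψ = −1/β and ∫_0^∞ F(x) dx = e^{−1} ∫_{−∞}^∞ F(x) dx. -/
open MeasureTheory Real Set

/-- The first moment of `exp (-b x)` over `(c, ∞)`. -/
theorem integral_mul_exp_neg_mul_Ioi {b : ℝ} (hb : 0 < b) (c : ℝ) :
    ∫ x in Ioi c, x * Real.exp (-b * x) = (c / b + 1 / b ^ 2) * Real.exp (-b * c) := by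
  have hO : (fun x : ℝ => x) =o[Filter.atTop] fun x => Real.exp (b / 2 * x) := by
    simpa using isLittleO_pow_exp_pos_mul_atTop 1 (half_pos hb)
  have hint : IntegrableOn (fun x => x * Real.exp (-b * x)) (Ioi c) := by
    refine integrable_of_isBigO_exp_neg (half_pos hb) (by fun_prop) ?_
    refine (hO.isBigO.mul (Asymptotics.isBigO_refl (fun x => Real.exp (-b * x)) _)).congr_right
      fun x => ?_
    rw [← Real.exp_add]
    ring_nf
  have hderiv : ∀ x ∈ Ici c, HasDerivAt (fun x => -(x / b + 1 / b ^ 2) * Real.exp (-b * x))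
      (x * Real.exp (-b * x)) x := by
    intro x _
    have h := (((hasDerivAt_id' x).div_const b).add_const (1 / b ^ 2)).fun_neg.fun_mul
      ((hasDerivAt_id' x).const_mul (-b)).exp
    refine h.congr_deriv ?_
    field_simp
    ring
  have hlim : Filter.Tendsto (fun x => -(x / b + 1 / b ^ 2) * Real.exp (-b * x)) Filter.atTop
      (nhds 0) := by
    have h₁ : Filter.Tendsto (fun x => x * Real.exp (-b * x)) Filter.atTop (nhds 0) := by
      simpa using tendsto_rpow_mul_exp_neg_mul_atTop_nhds_zero 1 b hb
    have h₀ : Filter.Tendsto (fun x => Real.exp (-b * x)) Filter.atTop (nhds 0) := by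
      simpa using tendsto_rpow_mul_exp_neg_mul_atTop_nhds_zero 0 b hb
    have h := ((h₁.const_mul (1 / b)).add (h₀.const_mul (1 / b ^ 2))).neg
    simp only [mul_zero, add_zero, neg_zero] at h
    refine h.congr fun x => ?_
    ring
  rw [integral_Ioi_of_hasDerivAt_of_tendsto' hderiv hint hlim]
  ring

/-- Grünbaum ratio of a truncated exponential: if
`F = 𝟙_{[Ψ,∞)} h e^{-βx}` has its center of mass at the origin, then
`Ψ = -1/β` and `∫_0^∞ F = e⁻¹ ∫_{-∞}^∞ F`. -/
theorem truncated_exponential_ratio (β h Ψ : ℝ) (hβ : 0 < β) (hh : 0 < h)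
    (F : ℝ → ℝ)
    (hF : F = Set.indicator (Set.Ici Ψ) (fun x => h * Real.exp (-β * x)))
    (hcom : (∫ x : ℝ, x * F x) = 0) :
    Ψ = -1 / β ∧
    (∫ x in Set.Ioi (0 : ℝ), F x) = Real.exp (-1) * ∫ x : ℝ, F x := by
  subst hF
  have hΨ : Ψ = -1 / β := by
    have hmul : (fun x => x * (Ici Ψ).indicator (fun x => h * Real.exp (-β * x)) x) =
        (Ici Ψ).indicator fun x => h * (x * Real.exp (-β * x)) := by
      funext x
      by_cases hx : x ∈ Ici Ψ
      · simp only [indicator_of_mem hx]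
        ring
      · simp only [indicator_of_notMem hx, mul_zero]
    rw [hmul, integral_indicator measurableSet_Ici, integral_Ici_eq_integral_Ioi,
      integral_const_mul, integral_mul_exp_neg_mul_Ioi hβ] at hcom
    have hzero : Ψ / β + 1 / β ^ 2 = 0 := by
      simpa [hh.ne', Real.exp_ne_zero] using hcom
    field_simp at hzero ⊢
    linarith
  refine ⟨hΨ, ?_⟩
  have hneg : Ψ ≤ 0 := by
    rw [hΨ]
    exact div_nonpos_of_nonpos_of_nonneg (by norm_num) hβ.le
  have hpos : ∫ x in Ioi (0 : ℝ), (Ici Ψ).indicator (fun x => h * Real.exp (-β * x)) x =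
      ∫ x in Ioi (0 : ℝ), h * Real.exp (-β * x) :=
    setIntegral_congr_fun measurableSet_Ioi fun x hx =>
      indicator_of_mem (mem_Ici.2 (hneg.trans (mem_Ioi.1 hx).le)) _
  have hmul : -β * Ψ = 1 := by
    rw [hΨ]
    field_simp
  rw [hpos, integral_indicator measurableSet_Ici, integral_Ici_eq_integral_Ioi,
    integral_const_mul, integral_const_mul, integral_exp_mul_Ioi (neg_lt_zero.2 hβ),
    integral_exp_mul_Ioi (neg_lt_zero.2 hβ), hmul, mul_zero, Real.exp_zero, Real.exp_neg]
  field_simp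
end

section
/- Let K ⊂ ℝⁿ be a convex body (a compact convex set with nonempty interior) whose center of mass ( ∫_K x dx ) / vol(K) is at the origin, and let θ ∈ Sⁿ⁻¹. Then the one-dimensional Lebesgue measure of {s ≥ 0 : sθ ∈ K} is at least e^{−n} times the one-dimensional Lebesgue measure of {s ∈ ℝ : sθ ∈ K}; that is, the portion of the chord K ∩ {sθ : s ∈ ℝ} lying on the positive side of the origin has length at least e^{−n} times the length of the whole chord. -/
open MeasureTheory Real Set
open Module Filter Topology Pointwise

section Centroid

variable {E : Type*} [NormedAddCommGroup E] [NormedSpace ℝ E] [MeasurableSpace E] [BorelSpace E]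
  [FiniteDimensional ℝ E] (μ : Measure E) [μ.IsAddHaarMeasure]

/-- If a convex body contains the origin and a linear functional is at most `M` on it, then the
mean of the functional over the body is at most `d / (d + 1) * M`, where `d` is the dimension. -/
theorem Convex.succ_finrank_mul_setIntegral_le {L : Set E} (hconv : Convex ℝ L)
    (hcomp : IsCompact L) (h0 : (0 : E) ∈ L) (f : E →L[ℝ] ℝ) {M : ℝ} (hM : ∀ y ∈ L, f y ≤ M) :
    ((finrank ℝ E : ℝ) + 1) * ∫ y in L, f y ∂μ ≤ finrank ℝ E * (M * μ.real L) := by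
  set d := finrank ℝ E
  set I := ∫ y in L, f y ∂μ
  have hint : IntegrableOn f L μ := f.continuous.continuousOn.integrableOn_compact hcomp
  have key : ∀ r ∈ Ioo (0 : ℝ) 1,
      (∑ i ∈ Finset.range (d + 1), r ^ i) * I ≤
        (∑ i ∈ Finset.range d, r ^ i) * (M * μ.real L) := by
    rintro r ⟨hr0, hr1⟩
    have hsub : r • L ⊆ L := by
      rintro _ ⟨y, hy, rfl⟩
      exact hconv.smul_mem_of_zero_mem h0 hy ⟨hr0.le, hr1.le⟩
    have hmeas : MeasurableSet (r • L) := (hcomp.smul r).measurableSet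
    have hvol : μ.real (r • L) = r ^ d * μ.real L := by
      rw [measureReal_def, Measure.addHaar_smul_of_nonneg μ hr0.le, ENNReal.toReal_mul,
        ENNReal.toReal_ofReal (by positivity), measureReal_def]
    have hscaled : ∫ y in r • L, f y ∂μ = r ^ (d + 1) * I := by
      have h := Measure.setIntegral_comp_smul_of_pos μ f L hr0
      simp only [map_smul, smul_eq_mul, integral_const_mul] at h
      have hr : r ^ d ≠ 0 := by positivity
      change r * I = (r ^ d)⁻¹ * _ at h
      rw [pow_succ, mul_assoc, h, mul_inv_cancel_left₀ hr]
    have hdiff : ∫ y in L \ r • L, f y ∂μ = I - r ^ (d + 1) * I := by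
      rw [setIntegral_sdiff hmeas hint hsub, hscaled]
    have hbound : ∫ y in L \ r • L, f y ∂μ ≤ M * (μ.real L - r ^ d * μ.real L) := by
      have hfin : μ (L \ r • L) ≠ ⊤ :=
        ((measure_mono sdiff_subset).trans_lt hcomp.measure_lt_top).ne
      calc ∫ y in L \ r • L, f y ∂μ ≤ ∫ _ in L \ r • L, M ∂μ :=
            setIntegral_mono_on (hint.mono_set sdiff_subset) (integrableOn_const hfin)
              (hcomp.measurableSet.diff hmeas) fun y hy => hM y hy.1
        _ = M * (μ.real L - r ^ d * μ.real L) := by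
            rw [setIntegral_const, measureReal_sdiff hsub hmeas hcomp.measure_lt_top.ne, hvol,
              smul_eq_mul, mul_comm]
    have h1 := mul_neg_geom_sum r (d + 1)
    have h2 := mul_neg_geom_sum r d
    refine le_of_mul_le_mul_left ?_ (sub_pos.2 hr1)
    rw [← mul_assoc, ← mul_assoc, h1, h2]
    linarith
  have htend : ∀ (m : ℕ) (c : ℝ),
      Tendsto (fun r : ℝ => (∑ i ∈ Finset.range m, r ^ i) * c) (𝓝[<] 1) (𝓝 (m * c)) := by
    intro m c
    have hcont : Continuous fun r : ℝ => (∑ i ∈ Finset.range m, r ^ i) * c := by fun_prop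
    simpa using (hcont.tendsto 1).mono_left nhdsWithin_le_nhds
  have hlim := le_of_tendsto_of_tendsto (htend (d + 1) I) (htend d (M * μ.real L))
    (by filter_upwards [Ioo_mem_nhdsLT (zero_lt_one' ℝ)] with r hr using key r hr)
  exact_mod_cast hlim

/-- Minkowski's inclusion: a convex body `K` of dimension `d` with centroid at the origin
satisfies `-K ⊆ d • K`. -/
theorem Convex.neg_inv_finrank_smul_mem {K : Set E} (hconv : Convex ℝ K) (hcomp : IsCompact K)
    (hint : (interior K).Nonempty) (hcentroid : ∫ y in K, y ∂μ = 0) (hd : 0 < finrank ℝ E)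
    {x : E} (hx : x ∈ K) : (-(finrank ℝ E : ℝ)⁻¹) • x ∈ K := by
  by_contra hmem
  obtain ⟨f, u, hfu, huf⟩ := geometric_hahn_banach_closed_point hconv hcomp.isClosed hmem
  have hd' : (0 : ℝ) < finrank ℝ E := by exact_mod_cast hd
  have hVpos : 0 < μ.real K :=
    ENNReal.toReal_pos (Measure.measure_pos_of_nonempty_interior μ hint).ne'
      hcomp.measure_lt_top.ne
  have hintf : IntegrableOn f K μ := f.continuous.continuousOn.integrableOn_compact hcomp
  have hf0 : ∫ y in K, f y ∂μ = 0 := by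
    have hid : IntegrableOn (fun y : E => y) K μ :=
      continuous_id.continuousOn.integrableOn_compact hcomp
    rw [f.integral_comp_comm hid, hcentroid, map_zero]
  have hmp := measurePreserving_add_right μ x
  have hemb := (Homeomorph.addRight x).measurableEmbedding
  have hpre : (fun y => y + x) ⁻¹' K = (fun y => y - x) '' K := by
    ext y
    simp [sub_eq_iff_eq_add]
  have hvol : μ.real ((fun y => y + x) ⁻¹' K) = μ.real K := by
    simp [measureReal_def]
  have hshift : ∫ y in (fun y => y + x) ⁻¹' K, f y ∂μ = -f x * μ.real K := by
    have h := hmp.setIntegral_preimage_emb hemb (fun y => f y - f x) K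
    simp only [map_add, add_sub_cancel_right] at h
    rw [h, integral_sub hintf (integrableOn_const hcomp.measure_lt_top.ne), hf0,
      setIntegral_const, smul_eq_mul]
    ring
  have hmain := Convex.succ_finrank_mul_setIntegral_le μ
    (hconv.translate_preimage_left x) (hpre ▸ hcomp.image (by fun_prop)) (by simpa using hx) f
    (M := u - f x) (fun y hy => by
      have := hfu _ hy
      rw [map_add] at this
      linarith)
  rw [hshift, hvol] at hmain
  have hle : ((finrank ℝ E : ℝ) + 1) * -f x ≤ finrank ℝ E * (u - f x) :=
    le_of_mul_le_mul_right (by linarith) hVpos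
  rw [map_smul, smul_eq_mul, neg_mul, ← mul_neg, inv_mul_eq_div, lt_div_iff₀ hd'] at huf
  linarith

end Centroid

/-- Generalized Grünbaum inequality for convex bodies, applied to chords:
if `K ⊂ ℝⁿ` is a convex body with center of mass at the origin and `θ` is a
unit vector, then the length of the part of the chord `K ∩ ℝθ` on the
positive side of the origin is at least `e^{-n}` times the whole chord. -/
theorem grunbaum_convex_body_chord (n : ℕ)
    (K : Set (EuclideanSpace ℝ (Fin n)))
    (hK_conv : Convex ℝ K) (hK_comp : IsCompact K)
    (hK_int : (interior K).Nonempty)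
    (hK_com : (∫ x in K, x) = 0)
    (θ : EuclideanSpace ℝ (Fin n)) (hθ : ‖θ‖ = 1) :
    ENNReal.ofReal (Real.exp (-(n : ℝ))) * volume {s : ℝ | s • θ ∈ K}
      ≤ volume {s : ℝ | 0 ≤ s ∧ s • θ ∈ K} := by
  have hn : 0 < n := by
    rcases Nat.eq_zero_or_pos n with rfl | h
    · simp [Subsingleton.elim θ 0] at hθ
    · exact h
  have hn' : (0 : ℝ) < n := by exact_mod_cast hn
  set P := {s : ℝ | 0 ≤ s ∧ s • θ ∈ K}
  have hcover : {s : ℝ | s • θ ∈ K} ⊆ P ∪ (-(n : ℝ)) • P := by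
    intro s hs
    rcases le_total 0 s with h | h
    · exact Or.inl ⟨h, hs⟩
    · refine Or.inr ⟨-(n : ℝ)⁻¹ * s, ⟨?_, ?_⟩, ?_⟩
      · exact mul_nonneg_of_nonpos_of_nonpos (by simp) h
      · have h := hK_conv.neg_inv_finrank_smul_mem volume hK_comp hK_int hK_com (by simpa) hs
        rwa [finrank_euclideanSpace_fin, smul_smul] at h
      · simp only [smul_eq_mul]
        field_simp
  have hchord : volume {s : ℝ | s • θ ∈ K} ≤ ENNReal.ofReal (n + 1) * volume P := by
    calc volume {s : ℝ | s • θ ∈ K} ≤ volume P + volume ((-(n : ℝ)) • P) :=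
          (measure_mono hcover).trans (measure_union_le _ _)
      _ = ENNReal.ofReal (n + 1) * volume P := by
          rw [Measure.addHaar_smul, finrank_self, pow_one, abs_neg, abs_of_pos hn',
            ENNReal.ofReal_add hn'.le zero_le_one, ENNReal.ofReal_one, add_mul, one_mul, add_comm]
  have hexp : Real.exp (-(n : ℝ)) * (n + 1) ≤ 1 := by
    rw [Real.exp_neg, inv_mul_le_one₀ (Real.exp_pos _)]
    exact Real.add_one_le_exp _
  calc ENNReal.ofReal (Real.exp (-(n : ℝ))) * volume {s : ℝ | s • θ ∈ K}
      ≤ ENNReal.ofReal (Real.exp (-(n : ℝ))) * (ENNReal.ofReal (n + 1) * volume P) := by gcongr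
    _ = ENNReal.ofReal (Real.exp (-(n : ℝ)) * (n + 1)) * volume P := by
        rw [← mul_assoc, ← ENNReal.ofReal_mul (Real.exp_pos _).le]
    _ ≤ 1 * volume P := by
        gcongr
        exact ENNReal.ofReal_le_one.2 hexp
    _ = volume P := one_mul _
end
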